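/- Let p be a prime, α ≥ 1, and r = p^α, and let k ≥ 1. Let C_1, …, C_k be pairwise disjoint finite subsets of ℝ^{pk−1} (the colors), each of cardinality (p + 1)r − 1. Then there exist pairwise disjoint subsets F_1, …, F_r of C_1 ∪ ⋯ ∪ C_k such that |F_s ∩ C_i| ≤ p for every s ∈ {1,…,r} and every i ∈ {1,…,k}, and ⋂_{s=1}^r conv(F_s) ≠ ∅. -/

import Mathlib

namespace ListChain

section Basic

variable {R : Type*} [CommRing R] {S T : Type*}

/-- Prepend a vertex to every simplex of an ordered chain. -/
noncomputable def consL (v : S) : (List S →₀ R) →ₗ[R] (List S →₀ R) :=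
  Finsupp.lmapDomain R R (List.cons v)

/-- The (augmented) boundary of a single ordered simplex. -/
noncomputable def bdryList (R : Type*) [CommRing R] : List S → (List S →₀ R)
  | [] => 0
  | v :: l => Finsupp.single l 1 - consL v (bdryList R l)

/-- The boundary operator of the augmented ordered chain complex on the vertex set `S`. -/
noncomputable def bdry : (List S →₀ R) →ₗ[R] (List S →₀ R) :=
  Finsupp.linearCombination R (bdryList R)

/-- The chain map induced by a map of vertices. -/
noncomputable def mapL (f : S → T) : (List S →₀ R) →ₗ[R] (List T →₀ R) :=
  Finsupp.lmapDomain R R (List.map f)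

/-- The linear functional extending a function on simplices. -/
noncomputable def evalL (f : List S → R) : (List S →₀ R) →ₗ[R] R :=
  Finsupp.linearCombination R f

@[simp] theorem consL_single (v : S) (l : List S) (r : R) :
    consL v (Finsupp.single l r) = Finsupp.single (v :: l) r := by
  simp [consL]

@[simp] theorem bdry_single (l : List S) :
    bdry (Finsupp.single l (1 : R)) = bdryList R l := by
  simp [bdry]

@[simp] theorem mapL_single (f : S → T) (l : List S) (r : R) :
    mapL f (Finsupp.single l r) = Finsupp.single (l.map f) r := by
  simp [mapL]

@[simp] theorem evalL_single (f : List S → R) (l : List S) :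
    evalL f (Finsupp.single l (1 : R)) = f l := by
  simp [evalL]

theorem lin_ext {M : Type*} [AddCommGroup M] [Module R M] {φ ψ : (List S →₀ R) →ₗ[R] M}
    (h : ∀ l, φ (Finsupp.single l 1) = ψ (Finsupp.single l 1)) : φ = ψ :=
  Finsupp.lhom_ext' fun l => LinearMap.ext_ring (by simpa using h l)

theorem lin_mem {M : Type*} [AddCommGroup M] [Module R M] {P : Set (List S)}
    {N : Submodule R M} (φ : (List S →₀ R) →ₗ[R] M)
    (h : ∀ l ∈ P, φ (Finsupp.single l 1) ∈ N) {c : List S →₀ R}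
    (hc : c ∈ Finsupp.supported R R P) : φ c ∈ N := by
  rw [Finsupp.supported_eq_span_single] at hc
  have : Submodule.span R ((fun i => Finsupp.single i (1 : R)) '' P) ≤ N.comap φ := by
    rw [Submodule.span_le]
    rintro _ ⟨l, hl, rfl⟩
    exact h l hl
  exact this hc

theorem lin_eq_on {M : Type*} [AddCommGroup M] [Module R M] {P : Set (List S)}
    (φ ψ : (List S →₀ R) →ₗ[R] M)
    (h : ∀ l ∈ P, φ (Finsupp.single l 1) = ψ (Finsupp.single l 1)) {c : List S →₀ R}
    (hc : c ∈ Finsupp.supported R R P) : φ c = ψ c := by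
  have := lin_mem (N := ⊥) (φ - ψ) (P := P) (fun l hl => by simp [h l hl]) hc
  simpa [sub_eq_zero] using this

theorem single_mem {P : Set (List S)} {l : List S} (h : l ∈ P) (r : R) :
    Finsupp.single l r ∈ Finsupp.supported R R P :=
  Finsupp.single_mem_supported R r h

theorem consL_mem {P Q : Set (List S)} {v : S} (h : ∀ l ∈ P, v :: l ∈ Q) {c : List S →₀ R}
    (hc : c ∈ Finsupp.supported R R P) : consL v c ∈ Finsupp.supported R R Q :=
  lin_mem _ (fun l hl => by rw [consL_single]; exact single_mem (h l hl) 1) hc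

theorem mapL_mem {P : Set (List S)} {Q : Set (List T)} {f : S → T} (h : ∀ l ∈ P, l.map f ∈ Q)
    {c : List S →₀ R} (hc : c ∈ Finsupp.supported R R P) :
    mapL f c ∈ Finsupp.supported R R Q :=
  lin_mem _ (fun l hl => by rw [mapL_single]; exact single_mem (h l hl) 1) hc

theorem bdry_consL (v : S) (c : List S →₀ R) :
    bdry (consL v c) = c - consL v (bdry c) := by
  have : bdry ∘ₗ consL v = LinearMap.id - consL v ∘ₗ (bdry (R := R)) :=
    lin_ext fun l => by simp [bdryList]
  exact LinearMap.congr_fun this c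

theorem bdry_bdry (c : List S →₀ R) : bdry (bdry c) = 0 := by
  have : bdry ∘ₗ bdry = (0 : (List S →₀ R) →ₗ[R] (List S →₀ R)) := by
    refine lin_ext fun l => ?_
    induction l with
    | nil => simp [bdryList]
    | cons v l ih =>
      simp only [LinearMap.comp_apply, bdry_single, LinearMap.zero_apply] at ih ⊢
      simp [bdryList, bdry_consL, ih]
  exact LinearMap.congr_fun this c

theorem mapL_consL (f : S → T) (v : S) (c : List S →₀ R) :
    mapL f (consL v c) = consL (f v) (mapL f c) := by
  have : mapL f ∘ₗ consL v = consL (f v) ∘ₗ (mapL (R := R) f) :=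
    lin_ext fun l => by simp
  exact LinearMap.congr_fun this c

theorem bdry_mapL (f : S → T) (c : List S →₀ R) :
    bdry (mapL f c) = mapL f (bdry c) := by
  have : bdry ∘ₗ mapL f = mapL f ∘ₗ (bdry (R := R)) := by
    refine lin_ext fun l => ?_
    induction l with
    | nil => simp [bdryList]
    | cons v l ih =>
      simp only [LinearMap.comp_apply, bdry_single, mapL_single] at ih
      simp [bdryList, mapL_consL, ih]
  exact LinearMap.congr_fun this c

theorem mapL_mapL {U : Type*} (f : S → T) (g : T → U) (c : List S →₀ R) :
    mapL g (mapL f c) = mapL (g ∘ f) c := by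
  have : mapL g ∘ₗ mapL f = mapL (R := R) (g ∘ f) := lin_ext fun l => by simp
  exact LinearMap.congr_fun this c

theorem mapL_id (c : List S →₀ R) : mapL id c = c := by
  have : mapL id = (LinearMap.id : (List S →₀ R) →ₗ[R] _) := lin_ext fun l => by simp
  exact LinearMap.congr_fun this c

theorem evalL_mapL (f : S → T) (F : List T → R) (c : List S →₀ R) :
    evalL F (mapL f c) = evalL (fun l => F (l.map f)) c := by
  have : evalL F ∘ₗ mapL f = evalL (fun l => F (l.map f)) := lin_ext fun l => by simp
  exact LinearMap.congr_fun this c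

theorem evalL_consL (v : S) (F : List S → R) (c : List S →₀ R) :
    evalL F (consL v c) = evalL (fun l => F (v :: l)) c := by
  have : evalL F ∘ₗ consL v = evalL (fun l => F (v :: l)) := lin_ext fun l => by simp
  exact LinearMap.congr_fun this c

theorem evalL_eq_zero {P : Set (List S)} {F : List S → R} (h : ∀ l ∈ P, F l = 0)
    {c : List S →₀ R} (hc : c ∈ Finsupp.supported R R P) : evalL F c = 0 := by
  simpa using lin_eq_on (evalL F) 0 (P := P) (fun l hl => by simp [h l hl]) hc

/-- Prepend a list of vertices to every simplex of a chain. -/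
noncomputable def appL (A : List S) : (List S →₀ R) →ₗ[R] (List S →₀ R) :=
  Finsupp.lmapDomain R R (A ++ ·)

/-- Append a list of vertices to every simplex of a chain. -/
noncomputable def appR (B : List S) : (List S →₀ R) →ₗ[R] (List S →₀ R) :=
  Finsupp.lmapDomain R R (· ++ B)

@[simp] theorem appL_single (A l : List S) (r : R) :
    appL A (Finsupp.single l r) = Finsupp.single (A ++ l) r := by
  simp [appL]

@[simp] theorem appR_single (A l : List S) (r : R) :
    appR A (Finsupp.single l r) = Finsupp.single (l ++ A) r := by
  simp [appR]

theorem consL_appR (v : S) (B : List S) (c : List S →₀ R) :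
    consL v (appR B c) = appR B (consL v c) := by
  have : consL v ∘ₗ appR B = appR B ∘ₗ consL (R := R) v := lin_ext fun l => by simp
  exact LinearMap.congr_fun this c

theorem consL_appL (v : S) (A : List S) (c : List S →₀ R) :
    consL v (appL A c) = appL (v :: A) c := by
  have : consL v ∘ₗ appL A = appL (R := R) (v :: A) := lin_ext fun l => by simp
  exact LinearMap.congr_fun this c

theorem bdryList_append (A B : List S) :
    bdryList R (A ++ B) = appR B (bdryList R A) + (-1 : R) ^ A.length • appL A (bdryList R B) := by
  induction A with
  | nil =>
    have : appL [] = (LinearMap.id : (List S →₀ R) →ₗ[R] _) := lin_ext fun l => by simp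
    simp [bdryList, this]
  | cons v A ih =>
    simp only [List.cons_append, bdryList, ih, map_sub, map_add, appR_single, consL_appR,
      map_smul, consL_appL, List.length_cons, pow_succ]
    module

/-- The support of a boundary consists of sublists. -/
theorem bdryList_mem (l : List S) :
    bdryList R l ∈ Finsupp.supported R R {l' | l'.Sublist l ∧ l'.length + 1 = l.length} := by
  induction l with
  | nil => simp [bdryList]
  | cons v l ih =>
    refine Submodule.sub_mem _ (single_mem (by simp) 1) (consL_mem ?_ ih)
    rintro l' ⟨h1, h2⟩
    exact ⟨h1.cons_cons v, by simp [h2]⟩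

end Basic

section Vandermonde

variable {R : Type*} [CommRing R]

/-- The Vandermonde product of a list. -/
def vdm : List R → R
  | [] => 1
  | v :: l => (l.map (· - v)).prod * vdm l

theorem vdm_map_add (c : R) (l : List R) : vdm (l.map (c + ·)) = vdm l := by
  induction l with
  | nil => rfl
  | cons v l ih => simp [vdm, ih, Function.comp_def]

theorem vdm_eq_zero_of_not_nodup {l : List R} (h : ¬ l.Nodup) : vdm l = 0 := by
  induction l with
  | nil => simp at h
  | cons v l ih =>
    by_cases hv : v ∈ l
    · have : (0 : R) ∈ l.map (· - v) := List.mem_map.2 ⟨v, hv, sub_self v⟩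
      rw [vdm, List.prod_eq_zero this, zero_mul]
    · rw [vdm, ih (fun h' => h (List.nodup_cons.2 ⟨hv, h'⟩)), mul_zero]

theorem vdm_ne_zero_of_nodup [IsDomain R] {l : List R} (h : l.Nodup) : vdm l ≠ 0 := by
  induction l with
  | nil => simp [vdm]
  | cons v l ih =>
    rw [List.nodup_cons] at h
    refine mul_ne_zero (List.prod_ne_zero ?_) (ih h.2)
    simp only [List.mem_map, not_exists, not_and, sub_eq_zero]
    rintro x hx rfl
    exact h.1 hx

theorem vdm_swap (A l : List R) (x y : R) : vdm (A ++ x :: y :: l) = -vdm (A ++ y :: x :: l) := by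
  induction A with
  | nil => simp [vdm]; ring
  | cons a A ih => simp [vdm, ih]; ring

theorem vdm_ofFn {n : ℕ} (f : Fin n → R) : vdm (List.ofFn f) = (Matrix.vandermonde f).det := by
  rw [Matrix.det_vandermonde]
  induction n with
  | zero => simp [vdm]
  | succ n ih =>
    rw [List.ofFn_succ, vdm, ih, Fin.prod_univ_succ, Fin.prod_Ioi_zero]
    congr 1
    · simp [List.map_ofFn, List.prod_ofFn]
    · exact Finset.prod_congr rfl fun i _ => by rw [Fin.prod_Ioi_succ]

theorem bdryList_ofFn {S : Type*} {n : ℕ} (f : Fin (n + 1) → S) :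
    bdryList R (List.ofFn f) =
      ∑ i : Fin (n + 1), Finsupp.single (List.ofFn (f ∘ i.succAbove)) ((-1 : R) ^ (i : ℕ)) := by
  induction n with
  | zero => simp [bdryList]
  | succ n ih =>
    rw [List.ofFn_succ, bdryList, ih, Fin.sum_univ_succ (n := n + 1), map_sum, sub_eq_add_neg,
      ← Finset.sum_neg_distrib]
    congr 1
    · simp [Function.comp_def]
    · refine Finset.sum_congr rfl fun i _ => ?_
      rw [consL_single, ← Finsupp.single_neg]
      simp [List.ofFn_succ, pow_succ]
      rfl

theorem evalL_vdm_bdryList {l : List R} (h : 2 ≤ l.length) :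
    evalL vdm (bdryList R l) = 0 := by
  obtain ⟨n, hn⟩ : ∃ n, l.length = n + 2 := ⟨l.length - 2, by omega⟩
  obtain ⟨f, rfl⟩ : ∃ f : Fin (n + 2) → R, l = List.ofFn f :=
    ⟨fun i => l.get (i.cast hn.symm), by
      refine List.ext_get (by simp [hn]) fun i h1 h2 => ?_
      rw [List.get_ofFn]
      rfl⟩
  set M : Matrix (Fin (n + 2)) (Fin (n + 2)) R :=
    Matrix.of fun i j => Fin.cases (1 : R) (fun j => f i ^ (j : ℕ)) j with hM
  have h0 : M.det = 0 :=
    Matrix.det_zero_of_column_eq (i := 0) (j := 1) (by simp) fun i => by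
      have : M i 1 = f i ^ 0 := rfl
      rw [this, pow_zero]
      rfl
  rw [Matrix.det_succ_column_zero] at h0
  rw [bdryList_ofFn, map_sum, ← h0]
  refine Finset.sum_congr rfl fun i _ => ?_
  have : M.submatrix i.succAbove Fin.succ = Matrix.vandermonde (f ∘ i.succAbove) := by
    ext a b
    simp [hM, Matrix.vandermonde]
  rw [this, ← vdm_ofFn, ← mul_one ((-1 : R) ^ (i : ℕ)), ← smul_eq_mul, ← Finsupp.smul_single,
    map_smul, evalL_single]
  simp [hM]

end Vandermonde

section Cochain

variable {p : ℕ} {S : Type*}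

/-- The product cochain: a product of `m` Vandermonde cochains of blocks of `p` consecutive
vertices, overlapping in one vertex. -/
def blockCochain (p : ℕ) (lab : ℕ → S → ZMod p) : ℕ → ℕ → List S → ZMod p
  | 0, _, l => if l.length = 1 then 1 else 0
  | m + 1, t, l =>
    vdm ((l.take p).map (lab t)) * blockCochain p lab m (t + 1) (l.drop (p - 1))

theorem blockCochain_nil (lab : ℕ → S → ZMod p) (m t : ℕ) : blockCochain p lab m t [] = 0 := by
  induction m generalizing t with
  | zero => simp [blockCochain]
  | succ m ih => simp [blockCochain, ih]

theorem blockCochain_append (hp : 2 ≤ p) (lab : ℕ → S → ZMod p) (m t : ℕ) (P : List S)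
    (hP : P.length + 1 = p) (z : S) (l : List S) :
    blockCochain p lab (m + 1) t (P ++ z :: l) =
      vdm ((P ++ [z]).map (lab t)) * blockCochain p lab m (t + 1) (z :: l) := by
  subst hP
  simp [blockCochain, List.take_append, List.take_of_length_le]

theorem evalL_mul_right {R : Type*} [CommRing R] (f : List S → R) (r : R) (c : List S →₀ R) :
    evalL (fun l => f l * r) c = evalL f c * r := by
  have : evalL (fun l => f l * r) = r • evalL f := lin_ext fun l => by simp [mul_comm]
  rw [this]; simp [mul_comm]

theorem evalL_appR {R : Type*} [CommRing R] (f : List S → R) (B : List S) (c : List S →₀ R) :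
    evalL f (appR B c) = evalL (fun l => f (l ++ B)) c := by
  have : evalL f ∘ₗ appR B = evalL (fun l => f (l ++ B)) := lin_ext fun l => by simp
  exact LinearMap.congr_fun this c

theorem evalL_appL {R : Type*} [CommRing R] (f : List S → R) (B : List S) (c : List S →₀ R) :
    evalL f (appL B c) = evalL (fun l => f (B ++ l)) c := by
  have : evalL f ∘ₗ appL B = evalL (fun l => f (B ++ l)) := lin_ext fun l => by simp
  exact LinearMap.congr_fun this c

theorem evalL_congr {R : Type*} [CommRing R] {P : Set (List S)} {f g : List S → R}
    (h : ∀ l ∈ P, f l = g l) {c : List S →₀ R} (hc : c ∈ Finsupp.supported R R P) :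
    evalL f c = evalL g c :=
  lin_eq_on _ _ (fun l hl => by simp [h l hl]) hc

theorem evalL_blockCochain_bdryList (hp : 2 ≤ p) (lab : ℕ → S → ZMod p) (m t : ℕ) (l : List S) :
    evalL (blockCochain p lab m t) (bdryList (ZMod p) l) = 0 := by
  induction m generalizing t l with
  | zero =>
    match l with
    | [] => simp [bdryList]
    | [a] => simp [bdryList, blockCochain]
    | [a, b] => simp [bdryList, blockCochain]
    | a :: b :: c :: l =>
      refine evalL_eq_zero ?_ (bdryList_mem _)
      rintro l' ⟨-, h⟩
      simp only [List.length_cons] at h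
      simp only [blockCochain]
      rw [if_neg]
      omega
  | succ m ih =>
    by_cases hl : l.length ≤ p
    · refine evalL_eq_zero ?_ (bdryList_mem _)
      rintro l' ⟨-, h⟩
      rw [blockCochain, List.drop_eq_nil_of_le (by omega), blockCochain_nil, mul_zero]
    · obtain ⟨P, z, y, l, rfl, hP⟩ : ∃ P z y l', l = P ++ z :: y :: l' ∧ P.length + 1 = p := by
        have h1 : l = l.take (p - 1) ++ l.drop (p - 1) := (List.take_append_drop _ _).symm
        match hd : l.drop (p - 1) with
        | [] => have := congrArg List.length hd; simp at this; omega
        | [z] => have := congrArg List.length hd; simp at this; omega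
        | z :: y :: l' =>
          exact ⟨l.take (p - 1), z, y, l', by rw [← hd]; exact h1, by simp; omega⟩
      have hV := evalL_vdm_bdryList (l := (P ++ [z, y]).map (lab t)) (by simp)
      have hmap : bdryList (ZMod p) ((P ++ [z, y]).map (lab t)) =
          mapL (lab t) (bdryList (ZMod p) (P ++ [z, y])) := by
        rw [← bdry_single, ← mapL_single, bdry_mapL, bdry_single]
      rw [hmap, evalL_mapL, bdryList_append, map_add, evalL_appR, map_smul, evalL_appL] at hV
      have IH := ih (t + 1) (z :: y :: l)
      rw [bdryList, map_sub, evalL_single, evalL_consL] at IH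
      rw [bdryList_append, map_add, evalL_appR, map_smul, evalL_appL]
      have e1 : evalL (fun q => blockCochain p lab (m + 1) t (q ++ z :: y :: l))
          (bdryList (ZMod p) P) = evalL (fun q => vdm ((q ++ [z, y]).map (lab t)) *
            blockCochain p lab m (t + 1) (y :: l)) (bdryList (ZMod p) P) := by
        refine evalL_congr ?_ (bdryList_mem _)
        rintro q ⟨-, hq⟩
        have := blockCochain_append hp lab m t (q ++ [z]) (by simp; omega) y l
        simpa using this
      have e2 : evalL (fun q => blockCochain p lab (m + 1) t (P ++ q))
          (bdryList (ZMod p) (z :: y :: l)) =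
          vdm ((P ++ [y]).map (lab t)) * blockCochain p lab m (t + 1) (y :: l) -
          vdm ((P ++ [z]).map (lab t)) * blockCochain p lab m (t + 1) (y :: l) := by
        rw [bdryList, map_sub, evalL_single, evalL_consL, blockCochain_append hp _ _ _ _ hP,
          sub_right_inj]
        simp only [blockCochain_append hp _ _ _ _ hP]
        simp only [mul_comm (vdm ((P ++ [z]).map (lab t)))]
        rw [evalL_mul_right, sub_eq_zero.1 IH]
      rw [e1, e2, evalL_mul_right]
      have e3 : evalL (fun q => vdm ((P ++ q).map (lab t))) (bdryList (ZMod p) [z, y]) =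
          vdm ((P ++ [y]).map (lab t)) - vdm ((P ++ [z]).map (lab t)) := by
        simp [bdryList]
      rw [e3, smul_eq_mul] at hV
      rw [smul_eq_mul]
      linear_combination blockCochain p lab m (t + 1) (y :: l) * hV

theorem evalL_blockCochain_bdry (hp : 2 ≤ p) (lab : ℕ → S → ZMod p) (m t : ℕ)
    (c : List S →₀ ZMod p) : evalL (blockCochain p lab m t) (bdry c) = 0 := by
  have : evalL (blockCochain p lab m t) ∘ₗ bdry = 0 := lin_ext fun l => by
    simpa using evalL_blockCochain_bdryList hp lab m t l
  exact LinearMap.congr_fun this c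

theorem blockCochain_map {T : Type*} (lab : ℕ → T → ZMod p) (lab' : ℕ → S → ZMod p) (f : S → T)
    (c : ℕ → ZMod p) (h : ∀ t v, lab t (f v) = c t + lab' t v) (m t : ℕ) (l : List S) :
    blockCochain p lab m t (l.map f) = blockCochain p lab' m t l := by
  induction m generalizing t l with
  | zero => simp [blockCochain]
  | succ m ih =>
    rw [blockCochain, blockCochain, ← List.map_drop, ih, ← List.map_take,
      ← vdm_map_add (c t) ((l.take p).map (lab' t)), List.map_map, List.map_map]
    congr 3
    funext v
    exact h t v

end Cochain

section Families

variable {p α : ℕ}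

variable {S T : Type*} [AddAction (Fin α → ZMod p) S] [AddAction (Fin α → ZMod p) T]

/-- The action of a group element on chains. -/
noncomputable def rho (g : Fin α → ZMod p) : (List S →₀ ZMod p) →ₗ[ZMod p] (List S →₀ ZMod p) :=
  mapL (g +ᵥ ·)

theorem rho_rho (g h : Fin α → ZMod p) (c : List S →₀ ZMod p) :
    rho g (rho h c) = rho (g + h) c := by
  simp only [rho, mapL_mapL]
  congr 2
  funext x
  simp [add_vadd]

theorem rho_zero (c : List S →₀ ZMod p) : rho (0 : Fin α → ZMod p) c = c := by
  rw [rho]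
  convert mapL_id c using 2
  simp only [zero_vadd]
  rfl

theorem bdry_rho (g : Fin α → ZMod p) (c : List S →₀ ZMod p) :
    bdry (rho g c) = rho g (bdry c) := bdry_mapL _ _

variable [Fact p.Prime]

/-- The alternating operators `g - 1` and `∑ g ^ m` of the periodic resolution of `ZMod p`. -/
noncomputable def dop (S : Type*) [AddAction (Fin α → ZMod p) S] (n : ℕ) (j : Fin α) :
    (List S →₀ ZMod p) →ₗ[ZMod p] (List S →₀ ZMod p) :=
  if n = 0 then 0
  else if Odd n then rho (Pi.single j 1) - LinearMap.id
  else ∑ m : ZMod p, rho (Pi.single j m)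

@[simp] theorem dop_zero (j : Fin α) : dop (p := p) S 0 j = 0 := by simp [dop]

theorem dop_odd {n : ℕ} (h : Odd n) (j : Fin α) (c : List S →₀ ZMod p) :
    dop S n j c = rho (Pi.single j 1) c - c := by
  have : n ≠ 0 := by rintro rfl; simp at h
  simp [dop, h, this]

theorem dop_even {n : ℕ} (h : Even n) (h0 : n ≠ 0) (j : Fin α) (c : List S →₀ ZMod p) :
    dop S n j c = ∑ m : ZMod p, rho (Pi.single j m) c := by
  simp [dop, h0, Nat.not_odd_iff_even.2 h]

theorem sum_rho_single_vadd (j : Fin α) (c : List S →₀ ZMod p) :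
    ∑ m : ZMod p, rho (Pi.single j m) (rho (Pi.single j 1) c) =
      ∑ m : ZMod p, rho (Pi.single j m) c := by
  simp only [rho_rho, ← Pi.single_add]
  exact Fintype.sum_equiv (Equiv.addRight 1) _ _ fun m => rfl

theorem dop_dop_self (n : ℕ) (j : Fin α) (c : List S →₀ ZMod p) :
    dop S (n + 1) j (dop S n j c) = 0 := by
  rcases Nat.eq_zero_or_pos n with rfl | hn
  · simp
  rcases Nat.even_or_odd n with h | h
  · rw [dop_odd h.add_one, dop_even h hn.ne', map_sum]
    simp only [rho_rho, ← Pi.single_add]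
    rw [sub_eq_zero]
    exact Fintype.sum_equiv (Equiv.addLeft 1) _ _ fun m => rfl
  · rw [dop_even h.add_one (by omega), dop_odd h]
    simp only [map_sub, Finset.sum_sub_distrib, sum_rho_single_vadd, sub_self]

theorem rho_comm (g h : Fin α → ZMod p) (c : List S →₀ ZMod p) :
    rho g (rho h c) = rho h (rho g c) := by rw [rho_rho, rho_rho, add_comm]

theorem dop_rho (n : ℕ) (j : Fin α) (g : Fin α → ZMod p) (c : List S →₀ ZMod p) :
    dop S n j (rho g c) = rho g (dop S n j c) := by
  simp only [dop]
  split_ifs <;> simp [rho_comm _ g]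

theorem dop_comm (n m : ℕ) (i j : Fin α) (c : List S →₀ ZMod p) :
    dop S n i (dop S m j c) = dop S m j (dop S n i c) := by
  conv_lhs => rw [dop.eq_1 S m]
  conv_rhs => rw [dop.eq_1 S m]
  split_ifs <;> simp [dop_rho]

/-- A linear map commuting with the group action commutes with `dop`. -/
theorem map_dop (φ : (List S →₀ ZMod p) →ₗ[ZMod p] (List T →₀ ZMod p))
    (h : ∀ (g : Fin α → ZMod p) c, φ (rho g c) = rho g (φ c)) (n : ℕ) (j : Fin α)
    (c : List S →₀ ZMod p) : φ (dop S n j c) = dop T n j (φ c) := by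
  simp only [dop]
  split_ifs <;> simp [h]

theorem dop_mem {P : Set (List S)} (hP : ∀ (g : Fin α → ZMod p), ∀ l ∈ P, l.map (g +ᵥ ·) ∈ P)
    (n : ℕ) (j : Fin α) {c : List S →₀ ZMod p}
    (hc : c ∈ Finsupp.supported (ZMod p) (ZMod p) P) :
    dop S n j c ∈ Finsupp.supported (ZMod p) (ZMod p) P := by
  have hr : ∀ g : Fin α → ZMod p, rho g c ∈ Finsupp.supported (ZMod p) (ZMod p) P :=
    fun g => mapL_mem (hP g) hc
  simp only [dop]
  split_ifs
  · simp
  · exact Submodule.sub_mem _ (hr _) hc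
  · rw [LinearMap.sum_apply]
    exact Submodule.sum_mem _ fun m _ => hr _

/-- The Koszul sign in the `j`-th direction. -/
def ksign (p : ℕ) (a : Fin α → ℕ) (j : Fin α) : ZMod p := (-1) ^ ∑ i ∈ Finset.Ioi j, a i

/-- The differential of the tensor product of periodic resolutions, acting on families of
chains indexed by multi-indices. -/
noncomputable def multiD (x : (Fin α → ℕ) → (List S →₀ ZMod p)) (a : Fin α → ℕ) :
    List S →₀ ZMod p :=
  ∑ j, ksign p a j • dop S (a j) j (x (a - Pi.single j 1))

theorem multiD_congr {x y : (Fin α → ℕ) → (List S →₀ ZMod p)} {a : Fin α → ℕ}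
    (h : ∀ j, a j ≠ 0 → x (a - Pi.single j 1) = y (a - Pi.single j 1)) :
    multiD x a = multiD y a := by
  refine Finset.sum_congr rfl fun j _ => ?_
  by_cases hj : a j = 0
  · simp [hj]
  · rw [h j hj]

theorem multiD_add (x y : (Fin α → ℕ) → (List S →₀ ZMod p)) (a : Fin α → ℕ) :
    multiD (fun b => x b + y b) a = multiD x a + multiD y a := by
  simp [multiD, Finset.sum_add_distrib]

theorem multiD_smul (r : ZMod p) (x : (Fin α → ℕ) → (List S →₀ ZMod p)) (a : Fin α → ℕ) :
    multiD (fun b => r • x b) a = r • multiD x a := by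
  simp [multiD, Finset.smul_sum, smul_comm r]

theorem map_multiD (φ : (List S →₀ ZMod p) →ₗ[ZMod p] (List T →₀ ZMod p))
    (h : ∀ (g : Fin α → ZMod p) c, φ (rho g c) = rho g (φ c))
    (x : (Fin α → ℕ) → (List S →₀ ZMod p)) (a : Fin α → ℕ) :
    φ (multiD x a) = multiD (fun b => φ (x b)) a := by
  simp [multiD, map_dop φ h]

theorem ksign_sub_of_lt {a : Fin α → ℕ} {i j : Fin α} (h : i < j) :
    ksign p (a - Pi.single i 1) j = ksign p a j := by
  unfold ksign
  congr 1
  refine Finset.sum_congr rfl fun k hk => ?_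
  have : k ≠ i := (h.trans (Finset.mem_Ioi.1 hk)).ne'
  simp [this]

theorem ksign_sub_of_gt {a : Fin α → ℕ} {i j : Fin α} (h : j < i) (ha : a i ≠ 0) :
    ksign p (a - Pi.single i 1) j = -ksign p a j := by
  unfold ksign
  have hi : i ∈ Finset.Ioi j := Finset.mem_Ioi.2 h
  rw [← Finset.add_sum_erase _ _ hi, ← Finset.add_sum_erase _ a hi]
  have : ∑ k ∈ (Finset.Ioi j).erase i, (a - Pi.single i 1 : Fin α → ℕ) k =
      ∑ k ∈ (Finset.Ioi j).erase i, a k :=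
    Finset.sum_congr rfl fun k hk => by simp [Finset.ne_of_mem_erase hk]
  rw [this]
  obtain ⟨n, hn⟩ := Nat.exists_eq_succ_of_ne_zero ha
  simp only [Pi.sub_apply, Pi.single_eq_same, hn, Nat.succ_eq_add_one, Nat.add_sub_cancel]
  ring

theorem multiD_multiD (x : (Fin α → ℕ) → (List S →₀ ZMod p)) (a : Fin α → ℕ) :
    multiD (multiD x) a = 0 := by
  simp only [multiD, map_sum, map_smul, Finset.smul_sum]
  rw [← Finset.sum_product']
  refine Finset.sum_involution (fun q _ => q.swap) ?_ ?_ (by simp) (by simp)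
  · rintro ⟨i, j⟩ -
    simp only [Prod.fst_swap, Prod.snd_swap]
    rcases eq_or_ne i j with rfl | hij
    · rcases hn : a i with _ | n
      · simp [hn]
      · simp [hn, dop_dop_self]
    · have e1 : (a - Pi.single i 1 : Fin α → ℕ) j = a j := by simp [hij.symm]
      have e2 : (a - Pi.single j 1 : Fin α → ℕ) i = a i := by simp [hij]
      rw [e1, e2, dop_comm, tsub_right_comm, smul_smul, smul_smul, ← add_smul]
      by_cases hi : a i = 0
      · simp [hi]
      by_cases hj : a j = 0
      · simp [hj]
      suffices h : ksign p a i * ksign p (a - Pi.single i 1) j +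
          ksign p a j * ksign p (a - Pi.single j 1) i = 0 by rw [h, zero_smul]
      rcases lt_or_gt_of_ne hij with h | h
      · rw [ksign_sub_of_lt h, ksign_sub_of_gt h hj]; ring
      · rw [ksign_sub_of_lt h, ksign_sub_of_gt h hi]; ring
  · rintro ⟨i, j⟩ - hne h
    apply hne
    obtain rfl : j = i := congrArg Prod.fst h
    rcases hn : a j with _ | n
    · simp [hn]
    · simp [hn, dop_dop_self]

theorem sum_sub_single {a : Fin α → ℕ} {j : Fin α} (hj : a j ≠ 0) :
    ∑ i, (a - Pi.single j 1 : Fin α → ℕ) i + 1 = ∑ i, a i := by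
  rw [← Finset.add_sum_erase _ _ (Finset.mem_univ j),
    ← Finset.add_sum_erase _ a (Finset.mem_univ j)]
  have : ∑ k ∈ Finset.univ.erase j, (a - Pi.single j 1 : Fin α → ℕ) k =
      ∑ k ∈ Finset.univ.erase j, a k :=
    Finset.sum_congr rfl fun k hk => by simp [Finset.ne_of_mem_erase hk]
  rw [this, Pi.sub_apply, Pi.single_eq_same]
  omega

theorem exists_family_eq (fill : ℕ → (List S →₀ ZMod p) → (List S →₀ ZMod p))
    (θ : (Fin α → ℕ) → (List S →₀ ZMod p)) (σ : ZMod p) :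
    ∃ x : (Fin α → ℕ) → (List S →₀ ZMod p),
      ∀ a, x a = fill (∑ i, a i) (θ a + σ • multiD x a) := by
  let X : ℕ → (Fin α → ℕ) → (List S →₀ ZMod p) := fun n =>
    Nat.rec (fun a => fill 0 (θ a + σ • multiD (fun _ => 0) a))
      (fun n X a => fill (n + 1) (θ a + σ • multiD X a)) n
  refine ⟨fun a => X (∑ i, a i) a, fun a => ?_⟩
  rcases hn : ∑ i, a i with _ | n
  · simp only [hn]
    change fill 0 _ = _
    congr 3
    refine multiD_congr fun j hj => ?_
    have := sum_sub_single hj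
    omega
  · simp only [hn]
    change fill (n + 1) _ = _
    congr 3
    refine multiD_congr fun j hj => ?_
    have := sum_sub_single hj
    rw [show ∑ i, (a - Pi.single j 1 : Fin α → ℕ) i = n by omega]

/-- A family of chains is built by filling cycles. -/
theorem exists_family (P : ℕ → Set (List S))
    (hP : ∀ n (g : Fin α → ZMod p), ∀ l ∈ P n, l.map (g +ᵥ ·) ∈ P n)
    (fill : ℕ → (List S →₀ ZMod p) → (List S →₀ ZMod p))
    (hfill : ∀ n, ∀ c ∈ Finsupp.supported (ZMod p) (ZMod p) (P n), bdry c = 0 →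
      fill n c ∈ Finsupp.supported (ZMod p) (ZMod p) (P (n + 1)) ∧ bdry (fill n c) = c)
    (θ : (Fin α → ℕ) → (List S →₀ ZMod p)) (σ : ZMod p)
    (hθP : ∀ a, θ a ∈ Finsupp.supported (ZMod p) (ZMod p) (P (∑ i, a i)))
    (hθ : ∀ a, bdry (θ a) + σ • multiD θ a = 0) :
    ∃ x : (Fin α → ℕ) → (List S →₀ ZMod p), ∀ a,
      x a ∈ Finsupp.supported (ZMod p) (ZMod p) (P (∑ i, a i + 1)) ∧
      bdry (x a) = θ a + σ • multiD x a ∧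
      x a = fill (∑ i, a i) (θ a + σ • multiD x a) := by
  obtain ⟨x, hx⟩ := exists_family_eq fill θ σ
  refine ⟨x, fun a => ?_⟩
  induction hn : ∑ i, a i using Nat.strong_induction_on generalizing a with
  | _ n ih =>
    have ih' : ∀ j, a j ≠ 0 → _ := fun j hj =>
      ih _ (by have := sum_sub_single hj; omega) (a - Pi.single j 1) rfl
    have hmem : θ a + σ • multiD x a ∈ Finsupp.supported (ZMod p) (ZMod p) (P n) := by
      refine Submodule.add_mem _ (hn ▸ hθP a) (Submodule.smul_mem _ _ ?_)
      refine Submodule.sum_mem _ fun j _ => Submodule.smul_mem _ _ ?_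
      by_cases hj : a j = 0
      · simp [hj]
      · have := (ih' j hj).1
        rw [sum_sub_single hj, hn] at this
        exact dop_mem (hP n) _ _ this
    have hcyc : bdry (θ a + σ • multiD x a) = 0 := by
      rw [map_add, map_smul, map_multiD bdry fun g c => bdry_rho g c,
        multiD_congr (y := fun b => θ b + σ • multiD x b) fun j hj => (ih' j hj).2.1,
        multiD_add, multiD_smul, multiD_multiD, smul_zero, add_zero, hθ]
    have h := hfill n _ hmem hcyc
    rw [← hn, ← hx a] at h
    exact ⟨hn ▸ h.1, h.2, hn ▸ hx a⟩

/-- The augmentation family. -/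
noncomputable def augFam (p : ℕ) (S : Type*) (a : Fin α → ℕ) : List S →₀ ZMod p :=
  if a = 0 then Finsupp.single [] 1 else 0

theorem multiD_augFam (a : Fin α → ℕ) : multiD (augFam p S) a = 0 := by
  refine Finset.sum_eq_zero fun j _ => ?_
  by_cases hj : a - Pi.single j 1 = 0
  · have h0 : augFam p S (a - Pi.single j 1) = Finsupp.single [] 1 := by simp [augFam, hj]
    have haj : a j ≤ 1 := by
      have := congrFun hj j
      simp at this
      omega
    rw [h0]
    rcases Nat.eq_zero_or_pos (a j) with h | h
    · simp [h]
    · obtain h1 : a j = 1 := by omega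
      rw [h1, dop_odd odd_one]
      simp [rho]
  · simp [augFam, hj]

theorem bdry_augFam (a : Fin α → ℕ) : bdry (augFam p S a) = 0 := by
  unfold augFam
  split_ifs <;> simp [bdryList]

/-- A resolution family: an equivariant map from the tensor product of periodic resolutions. -/
def IsFamily (x : (Fin α → ℕ) → (List S →₀ ZMod p)) : Prop :=
  ∀ a, bdry (x a) = augFam p S a + multiD x a

theorem IsFamily.map {x : (Fin α → ℕ) → (List S →₀ ZMod p)} (hx : IsFamily x)
    (φ : (List S →₀ ZMod p) →ₗ[ZMod p] (List T →₀ ZMod p))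
    (hb : ∀ c, bdry (φ c) = φ (bdry c))
    (h : ∀ (g : Fin α → ZMod p) c, φ (rho g c) = rho g (φ c))
    (h0 : φ (Finsupp.single [] 1) = Finsupp.single [] 1) :
    IsFamily fun a => φ (x a) := fun a => by
  have : φ (augFam p S a) = augFam p T a := by
    unfold augFam; split_ifs <;> simp [h0]
  rw [hb, hx a, map_add, map_multiD φ h, this]

theorem evalL_dop {F : List S → ZMod p} (hF : ∀ (g : Fin α → ZMod p) l, F (l.map (g +ᵥ ·)) = F l)
    (n : ℕ) (j : Fin α) (c : List S →₀ ZMod p) : evalL F (dop S n j c) = 0 := by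
  have hr : ∀ g : Fin α → ZMod p, evalL F (rho g c) = evalL F c := fun g => by
    rw [rho, evalL_mapL]; simp only [hF]
  simp only [dop]
  split_ifs
  · simp
  · simp [hr]
  · simp [hr]

/-- An invariant cocycle takes the same value on two resolution families. -/
theorem evalL_family_eq {F : List S → ZMod p}
    (hF : ∀ (g : Fin α → ZMod p) l, F (l.map (g +ᵥ ·)) = F l)
    (hFd : ∀ c, evalL F (bdry c) = 0) (v : S) {x y : (Fin α → ℕ) → (List S →₀ ZMod p)}
    (hx : IsFamily x) (hy : IsFamily y) (a : Fin α → ℕ) : evalL F (x a) = evalL F (y a) := by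
  obtain ⟨s, hs⟩ := exists_family (fun _ => (Set.univ : Set (List S))) (by simp)
    (fun _ => consL v) (fun n c _ hc => ⟨by simp, by rw [bdry_consL, hc]; simp⟩)
    (fun a => x a - y a) (-1) (by simp) (fun a => by
      have : multiD (fun a => x a - y a) a = multiD x a - multiD y a := by
        simp [multiD, Finset.sum_sub_distrib, smul_sub]
      rw [map_sub, hx a, hy a, this, neg_one_smul]
      abel)
  have h1 := congrArg (evalL F) (hs a).2.1
  rw [hFd, map_add, map_sub] at h1
  have h2 : evalL F (multiD s a) = 0 := by
    simp [multiD, evalL_dop hF]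
  rw [map_smul, h2, smul_zero, add_zero] at h1
  exact (sub_eq_zero.1 h1.symm)

end Families

section VandermondeSum

variable {p : ℕ} [Fact p.Prime]

/-- The Vandermonde sums appearing in the evaluation of the product cochain. -/
def vsum (p : ℕ) [Fact p.Prime] : ℕ → ℕ → List (ZMod p) → ZMod p → ZMod p
  | 0, _, A, z => vdm (A ++ [z])
  | u + 1, n, A, z =>
    if Odd n then vsum p u (n - 1) (A ++ [z]) (z + 1) - vsum p u (n - 1) (A ++ [z]) z
    else ∑ m : ZMod p, vsum p u (n - 1) (A ++ [z]) (z + m)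

/-- Replace every `x` in a list by `x, x + 1`. -/
def pairs (l : List (ZMod p)) : List (ZMod p) := l.flatMap fun x => [x, x + 1]

theorem vdm_pairs_perm {l l' : List (ZMod p)} (h : l.Perm l') (A : List (ZMod p)) :
    vdm (A ++ pairs l) = vdm (A ++ pairs l') := by
  induction h generalizing A with
  | nil => rfl
  | cons x _ ih => simpa [pairs] using ih (A ++ [x, x + 1])
  | swap x y l =>
    have h1 := vdm_swap A ((y + 1) :: (x + 1) :: pairs l) y x
    have h3 := vdm_swap (A ++ [y]) ((x + 1) :: pairs l) (y + 1) x
    have h4 := vdm_swap (A ++ [x, y]) (pairs l) (y + 1) (x + 1)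
    have h5 := vdm_swap (A ++ [x]) ((y + 1) :: pairs l) y (x + 1)
    simp only [pairs, List.flatMap_cons, List.append_assoc, List.cons_append, List.nil_append]
      at *
    rw [h3, h1, neg_neg, h4, h5, neg_neg]
  | trans _ _ h1 h2 => rw [h1, h2]

theorem vsum_eq_zero {A : List (ZMod p)} {z : ZMod p} (h : ¬ (A ++ [z]).Nodup) (u n : ℕ) :
    vsum p u n A z = 0 := by
  induction u generalizing n A z with
  | zero => exact vdm_eq_zero_of_not_nodup h
  | succ u ih =>
    have h' : ∀ y, ¬ (A ++ [z] ++ [y]).Nodup := fun y hy => h (List.Nodup.of_append_left hy)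
    simp [vsum, ih (h' _)]

theorem vsum_even (q : ℕ) (n : ℕ) (hn : Even n) (hq : 2 * q ≤ n) (A : List (ZMod p))
    (z : ZMod p) :
    vsum p (2 * q) n A z = ∑ f : Fin q → ZMod p, vdm (A ++ z :: pairs (List.ofFn f)) := by
  induction q generalizing n A z with
  | zero => simp [vsum, pairs]
  | succ q ih =>
    have hodd : Odd (n - 1) := by
      obtain ⟨k, rfl⟩ := hn
      exact ⟨k - 1, by omega⟩
    have hev : Even (n - 1 - 1) := by
      obtain ⟨k, rfl⟩ := hn
      exact ⟨k - 1, by omega⟩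
    rw [show 2 * (q + 1) = 2 * q + 1 + 1 by ring, vsum, if_neg (Nat.not_odd_iff_even.2 hn)]
    simp only [vsum, if_pos hodd]
    have h0 : ∀ x, vsum p (2 * q) (n - 1 - 1) (A ++ [z] ++ [x]) x = 0 := fun x =>
      vsum_eq_zero (by simp [List.nodup_append]) _ _
    simp only [h0, sub_zero, ih _ hev (by omega)]
    rw [← (Fin.consEquiv fun _ : Fin (q + 1) => ZMod p).sum_comp, Fintype.sum_prod_type]
    refine Fintype.sum_equiv (Equiv.addLeft z) _ _ fun m => Finset.sum_congr rfl fun f _ => ?_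
    simp [pairs, Fin.consEquiv]

theorem pairs_odds (q : ℕ) :
    (0 : ZMod p) :: pairs (List.ofFn fun j : Fin q => ((2 * j + 1 : ℕ) : ZMod p)) =
      (List.range (2 * q + 1)).map Nat.cast := by
  induction q with
  | zero => simp [pairs]
  | succ q ih =>
    rw [List.ofFn_succ', List.concat_eq_append, pairs, List.flatMap_append, ← List.cons_append,
      show 2 * (q + 1) + 1 = 2 * q + 1 + 1 + 1 by ring, List.range_succ, List.range_succ,
      List.map_append, List.map_append, ← ih]
    simp only [pairs, Fin.val_castSucc, Fin.val_last]
    simp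
    ring_nf

theorem vdm_odds_ne_zero {q : ℕ} (hq : p = 2 * q + 1) :
    vdm ((0 : ZMod p) :: pairs (List.ofFn fun j : Fin q => ((2 * j + 1 : ℕ) : ZMod p))) ≠ 0 := by
  rw [pairs_odds]
  refine vdm_ne_zero_of_nodup (List.Nodup.map_on ?_ List.nodup_range)
  intro x hx y hy h
  rw [ZMod.natCast_eq_natCast_iff'] at h
  rw [List.mem_range, ← hq] at hx hy
  rwa [Nat.mod_eq_of_lt hx, Nat.mod_eq_of_lt hy] at h

theorem pairs_length (l : List (ZMod p)) : (pairs l).length = 2 * l.length := by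
  simp [pairs, mul_comm]

theorem mem_pairs {l : List (ZMod p)} {x : ZMod p} :
    x ∈ pairs l ↔ x ∈ l ∨ x - 1 ∈ l := by
  simp only [pairs, List.mem_flatMap, List.mem_cons, List.not_mem_nil, or_false]
  constructor
  · rintro ⟨a, ha, rfl | rfl⟩
    · exact Or.inl ha
    · right; simpa using ha
  · rintro (h | h)
    · exact ⟨x, h, Or.inl rfl⟩
    · exact ⟨x - 1, h, Or.inr (by ring)⟩

theorem pairs_nodup_disjoint {l : List (ZMod p)} (h : (pairs l).Nodup) {x : ZMod p}
    (hx : x ∈ l) : x + 1 ∉ l := by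
  have hp1 : (1 : ZMod p) ≠ 0 := one_ne_zero
  induction l with
  | nil => simp at hx
  | cons y l ih =>
    simp only [pairs, List.flatMap_cons] at h
    rw [List.nodup_append] at h
    obtain ⟨-, h2, h3⟩ := h
    have h3' : ∀ a ∈ [y, y + 1], a ∉ pairs l := fun a ha hb => h3 a ha a hb rfl
    have ha := h3' y (by simp)
    have hb := h3' (y + 1) (by simp)
    rw [mem_pairs, not_or] at ha hb
    rw [List.mem_cons] at hx ⊢
    rintro (hy | hy)
    · rcases hx with rfl | hx
      · simp at hy
      · exact ha.2 (by rw [← hy]; simpa using hx)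
    · rcases hx with rfl | hx
      · exact hb.1 hy
      · exact ih h2 hx hy

theorem exists_perm_of_nodup {q : ℕ} (hq : p = 2 * q + 1) {f : Fin q → ZMod p}
    (h : ((0 : ZMod p) :: pairs (List.ofFn f)).Nodup) :
    ∃ σ : Equiv.Perm (Fin q), f = (fun j : Fin q => ((2 * j + 1 : ℕ) : ZMod p)) ∘ σ := by
  have hcov : ∀ x : ZMod p, x ∈ (0 : ZMod p) :: pairs (List.ofFn f) := by
    intro x
    have h1 := List.toFinset_card_of_nodup h
    rw [List.length_cons, pairs_length, List.length_ofFn, ← hq] at h1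
    have h2 := Finset.eq_univ_of_card _ (h1.trans (ZMod.card p).symm)
    have := Finset.mem_univ x
    rw [← h2, List.mem_toFinset] at this
    exact this
  rw [List.nodup_cons] at h
  have key : ∀ j, j ≤ q → ((2 * j : ℕ) : ZMod p) ∉ List.ofFn f ∧
      (j < q → ((2 * j + 1 : ℕ) : ZMod p) ∈ List.ofFn f) := by
    have step : ∀ j, ((2 * j : ℕ) : ZMod p) ∉ List.ofFn f → j < q →
        ((2 * j + 1 : ℕ) : ZMod p) ∈ List.ofFn f := by
      intro j hj hjq
      rcases List.mem_cons.1 (hcov ((2 * j + 1 : ℕ) : ZMod p)) with h0 | h0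
      · rw [ZMod.natCast_eq_zero_iff] at h0
        have := Nat.le_of_dvd (by omega) h0
        omega
      · rcases mem_pairs.1 h0 with h1 | h1
        · exact h1
        · exact absurd (by simpa using h1) hj
    intro j
    induction j with
    | zero =>
      intro _
      have h0 : ((2 * 0 : ℕ) : ZMod p) ∉ List.ofFn f := fun h0 =>
        h.1 (mem_pairs.2 (Or.inl (by simpa using h0)))
      exact ⟨h0, step 0 h0⟩
    | succ j ih =>
      intro hj
      have h1 := (ih (by omega)).2 (by omega)
      have h0 := pairs_nodup_disjoint h.2 h1
      have h0' : ((2 * (j + 1) : ℕ) : ZMod p) ∉ List.ofFn f := by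
        convert h0 using 1
        push_cast; ring
      exact ⟨h0', step _ h0'⟩
  have hex : ∀ j : Fin q, ∃ i, f i = ((2 * j + 1 : ℕ) : ZMod p) := fun j => by
    have := (key j (by omega)).2 j.2
    rwa [List.mem_ofFn] at this
  choose τ hτ using hex
  have hinj : Function.Injective τ := fun a b hab => by
    have h1 := (hτ a).symm.trans ((congrArg f hab).trans (hτ b))
    rw [ZMod.natCast_eq_natCast_iff', Nat.mod_eq_of_lt (by omega), Nat.mod_eq_of_lt (by omega)]
      at h1
    exact Fin.ext (by omega)
  refine ⟨(Equiv.ofBijective τ (Finite.injective_iff_bijective.1 hinj)).symm, ?_⟩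
  funext i
  obtain ⟨j, rfl⟩ := (Finite.injective_iff_bijective.1 hinj).2 i
  simp [Equiv.ofBijective_symm_apply_apply, hτ]

theorem vsum_ne_zero {n : ℕ} (hn : p - 1 ∣ n) (hn0 : p - 1 ≤ n) : vsum p (p - 1) n [] 0 ≠ 0 := by
  have hp : p.Prime := Fact.out
  rcases hp.eq_two_or_odd' with rfl | hodd
  · have h01 : vdm [(0 : ZMod 2), 1] = 1 := by simp [vdm]
    have h00 : vdm [(0 : ZMod 2), 0] = 0 := by simp [vdm]
    simp only [Nat.add_one_sub_one, vsum, List.nil_append, List.cons_append, zero_add]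
    split_ifs
    · simp [h01, h00]
    · have : ∀ F : ZMod 2 → ZMod 2, ∑ m, F m = F 0 + F 1 := fun F => Fin.sum_univ_two F
      rw [this, h01, h00]
      simp
  · obtain ⟨q, hq⟩ := hodd
    have h2q : p - 1 = 2 * q := by omega
    rw [h2q] at hn hn0 ⊢
    rw [vsum_even q n ((even_two_mul q).trans_dvd hn) hn0]
    set o : Fin q → ZMod p := fun j : Fin q => ((2 * j + 1 : ℕ) : ZMod p) with ho
    have hoinj : Function.Injective o := fun a b h1 => by
      simp only [ho] at h1
      rw [ZMod.natCast_eq_natCast_iff', Nat.mod_eq_of_lt (by omega), Nat.mod_eq_of_lt (by omega)]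
        at h1
      exact Fin.ext (by omega)
    have hsum : ∑ f : Fin q → ZMod p, vdm ([] ++ 0 :: pairs (List.ofFn f)) =
        ∑ σ : Equiv.Perm (Fin q), vdm (0 :: pairs (List.ofFn (o ∘ σ))) := by
      symm
      refine Finset.sum_of_injOn (fun σ => o ∘ σ) ?_ (by simp) ?_ (fun _ _ => rfl)
      · intro σ _ τ _ h
        exact Equiv.ext fun i => hoinj (congrFun h i)
      · intro f _ hf
        refine vdm_eq_zero_of_not_nodup fun hnd => hf ?_
        obtain ⟨σ, hσ⟩ := exists_perm_of_nodup hq hnd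
        exact ⟨σ, by simp, hσ.symm⟩
    have hval : ∀ σ : Equiv.Perm (Fin q), vdm (0 :: pairs (List.ofFn (o ∘ σ))) =
        vdm (0 :: pairs (List.ofFn o)) := fun σ =>
      vdm_pairs_perm (Equiv.Perm.ofFn_comp_perm σ o) [0]
    rw [hsum, Finset.sum_congr rfl fun σ _ => hval σ, Finset.sum_const, Finset.card_univ,
      Fintype.card_perm, Fintype.card_fin, nsmul_eq_mul]
    refine mul_ne_zero ?_ (vdm_odds_ne_zero hq)
    rw [Ne, ZMod.natCast_eq_zero_iff, hp.dvd_factorial]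
    omega

end VandermondeSum

section Evaluation

variable {p α : ℕ} [Fact p.Prime]

/-- The number of steps of a list of group elements in the direction of the `J`-th coordinate. -/
noncomputable def stepCount (J : Fin α) : List (Fin α → ZMod p) → ℕ
  | [] => 0
  | [_] => 0
  | g :: h :: l =>
    open Classical in (if ∃ m, h = g + Pi.single J m then 1 else 0) + stepCount J (h :: l)

theorem stepCount_map (J : Fin α) (g : Fin α → ZMod p) (l : List (Fin α → ZMod p)) :
    stepCount J (l.map (g +ᵥ ·)) = stepCount J l := by
  match l with
  | [] => rfl
  | [_] => rfl
  | a :: b :: l =>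
    have := stepCount_map J g (b :: l)
    rw [List.map_cons] at this
    rw [List.map_cons, List.map_cons, stepCount.eq_3, stepCount.eq_3, this]
    simp only [vadd_eq_add, add_assoc, add_right_inj]

theorem stepCount_cons_le (J : Fin α) (g : Fin α → ZMod p) (l : List (Fin α → ZMod p)) :
    stepCount J (g :: l) ≤ stepCount J l + 1 := by
  match l with
  | [] => simp [stepCount]
  | b :: l =>
    rw [stepCount]
    split_ifs <;> omega

theorem stepCount_le_cons (J : Fin α) (g : Fin α → ZMod p) (l : List (Fin α → ZMod p)) :
    stepCount J l ≤ stepCount J (g :: l) := by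
  match l with
  | [] => simp [stepCount]
  | b :: l =>
    rw [stepCount.eq_3]
    omega

theorem stepCount_le_drop (J : Fin α) (n : ℕ) (l : List (Fin α → ZMod p)) :
    stepCount J l ≤ stepCount J (l.drop n) + n := by
  induction n generalizing l with
  | zero => simp
  | succ n ih =>
    match l with
    | [] => simp [stepCount]
    | g :: l =>
      have h1 := stepCount_cons_le J g l
      have h2 := ih l
      rw [List.drop_succ_cons]
      omega

theorem stepCount_le_drop_of_nodup (J : Fin α) (χ : (Fin α → ZMod p) → ZMod p)
    (hχ : ∀ g m, χ (g + Pi.single J m) = χ g) (n : ℕ) (l : List (Fin α → ZMod p))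
    (hl : ((l.take (n + 1)).map χ).Nodup) :
    stepCount J l ≤ stepCount J (l.drop n) := by
  induction n generalizing l with
  | zero => simp
  | succ n ih =>
    match l with
    | [] => simp [stepCount]
    | [g] => simp [stepCount]
    | g :: h :: l =>
      rw [List.take_succ_cons, List.map_cons, List.nodup_cons] at hl
      have h2 := ih _ hl.2
      have h3 : ¬ ∃ m, h = g + Pi.single J m := by
        rintro ⟨m, rfl⟩
        apply hl.1
        rw [List.take_succ_cons, List.map_cons, hχ]
        exact List.mem_cons_self
      rw [List.drop_succ_cons]
      simpa [stepCount, h3] using h2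

/-- The multidegree supporting the product of `m` blocks starting at `t`, where the `i`-th block
has direction `L i`. -/
def blockDeg (p : ℕ) (L : ℕ → Fin α) : ℕ → ℕ → Fin α → ℕ
  | 0, _ => 0
  | m + 1, t => blockDeg p L m (t + 1) + Pi.single (L t) (p - 1)

theorem sum_blockDeg (L : ℕ → Fin α) (m t : ℕ) :
    ∑ i, blockDeg p L m t i = m * (p - 1) := by
  induction m generalizing t with
  | zero => simp [blockDeg]
  | succ m ih =>
    simp only [blockDeg, Pi.add_apply, Finset.sum_add_distrib, ih, Finset.sum_pi_single',
      Finset.mem_univ, if_true]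
    ring

theorem dvd_blockDeg (L : ℕ → Fin α) (m t : ℕ) (j : Fin α) : p - 1 ∣ blockDeg p L m t j := by
  induction m generalizing t with
  | zero => simp [blockDeg]
  | succ m ih =>
    rw [blockDeg, Pi.add_apply]
    refine dvd_add (ih _) ?_
    by_cases h : j = L t
    · subst h; simp
    · simp [h]

theorem blockDeg_eq_zero {L : ℕ → Fin α} {j : Fin α} {m t : ℕ} (h : ∀ i, t ≤ i → L i < j) :
    blockDeg p L m t j = 0 := by
  induction m generalizing t with
  | zero => simp [blockDeg]
  | succ m ih =>
    rw [blockDeg, Pi.add_apply, ih fun i hi => h i (by omega)]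
    simp [(h t le_rfl).ne']

variable {L : ℕ → Fin α} {χ : ℕ → (Fin α → ZMod p) → ZMod p}

theorem blockCochain_eq_zero_of_stepCount
    (hχ0 : ∀ i j, L i < j → ∀ g m, χ i (g + Pi.single j m) = χ i g)
    {J : Fin α} {m t : ℕ} (hJ : ∀ i, t ≤ i → L i ≤ J) {l : List (Fin α → ZMod p)}
    (hl : blockDeg p L m t J < stepCount J l) : blockCochain p χ m t l = 0 := by
  have hp : 2 ≤ p := (Fact.out : p.Prime).two_le
  induction m generalizing t l with
  | zero =>
    rw [blockCochain, if_neg]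
    intro h1
    obtain ⟨a, rfl⟩ := List.length_eq_one_iff.1 h1
    simp [stepCount] at hl
  | succ m ih =>
    rw [blockCochain]
    by_cases hnd : ((l.take p).map (χ t)).Nodup
    · rw [ih (fun i hi => hJ i (by omega)), mul_zero]
      rw [blockDeg, Pi.add_apply] at hl
      by_cases hLt : L t = J
      · have := stepCount_le_drop J (p - 1) l
        rw [hLt, Pi.single_eq_same] at hl
        omega
      · have h1 := stepCount_le_drop_of_nodup J (χ t)
          (hχ0 t J (lt_of_le_of_ne (hJ t le_rfl) hLt)) (p - 1) l
          (by rwa [show p - 1 + 1 = p by omega])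
        rw [Pi.single_eq_of_ne (Ne.symm hLt)] at hl
        omega
    · rw [vdm_eq_zero_of_not_nodup hnd, zero_mul]

theorem exists_cone_family (p α : ℕ) [Fact p.Prime] :
    ∃ ψ : (Fin α → ℕ) → (List (Fin α → ZMod p) →₀ ZMod p), IsFamily ψ ∧
      ∀ a, ψ a = consL 0 (augFam p _ a + multiD ψ a) := by
  obtain ⟨ψ, hψ⟩ := exists_family (p := p) (α := α) (S := Fin α → ZMod p)
    (fun _ => Set.univ) (by simp)
    (fun _ => consL 0) (fun n c _ hc => ⟨by simp, by rw [bdry_consL, hc]; simp⟩)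
    (augFam p _) 1 (by simp) (fun a => by rw [bdry_augFam, multiD_augFam]; simp)
  exact ⟨ψ, fun a => by simpa using (hψ a).2.1, fun a => by simpa using (hψ a).2.2⟩

variable {ψ : (Fin α → ℕ) → (List (Fin α → ZMod p) →₀ ZMod p)}

theorem cone_family_mem (hψ : ∀ a, ψ a = consL 0 (augFam p _ a + multiD ψ a)) (a : Fin α → ℕ) :
    ψ a ∈ Finsupp.supported (ZMod p) (ZMod p)
      {l | (∀ J, a J ≤ stepCount J l) ∧ ∃ l', l = 0 :: l'} := by
  induction hn : ∑ i, a i using Nat.strong_induction_on generalizing a with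
  | _ n ih =>
    rw [hψ a, map_add, multiD, map_sum]
    refine Submodule.add_mem _ ?_ (Submodule.sum_mem _ fun j _ => ?_)
    · unfold augFam
      split_ifs with h
      · rw [consL_single]
        exact single_mem (P := {l | (∀ J, a J ≤ stepCount J l) ∧ ∃ l', l = 0 :: l'})
          ⟨by simp [h], [], rfl⟩ 1
      · simp
    · by_cases hj : a j = 0
      · simp [hj]
      rw [map_smul]
      refine Submodule.smul_mem _ _ ?_
      have hmem := ih _ (by have := sum_sub_single hj; omega) (a - Pi.single j 1) rfl
      have hle : ∀ (J : Fin α) (l : List (Fin α → ZMod p)), (a - Pi.single j 1 : Fin α → ℕ) J ≤ stepCount J l →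
          J ≠ j → a J ≤ stepCount J l := fun J l h hJ => by simpa [hJ] using h
      have key : ∀ m, consL (0 : Fin α → ZMod p) (rho (Pi.single j m) (ψ (a - Pi.single j 1))) ∈
          Finsupp.supported (ZMod p) (ZMod p)
            {l | (∀ J, a J ≤ stepCount J l) ∧ ∃ l', l = 0 :: l'} := by
        intro m
        refine lin_mem (consL 0 ∘ₗ rho (Pi.single j m)) ?_ hmem
        rintro _ ⟨h1, l', rfl⟩
        rw [LinearMap.comp_apply, rho, mapL_single, consL_single]
        refine single_mem (P := {l | (∀ J, a J ≤ stepCount J l) ∧ ∃ l', l = 0 :: l'})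
          ⟨fun J => ?_, _, rfl⟩ 1
        have h2 := h1 J
        rw [← stepCount_map J (Pi.single j m)] at h2
        by_cases hJ : J = j
        · subst hJ
          have h3 : ∃ m' : ZMod p, ((Pi.single J m : Fin α → ZMod p) +ᵥ (0 : Fin α → ZMod p)) =
              0 + Pi.single J m' :=
            ⟨m, by simp⟩
          rw [List.map_cons] at h2 ⊢
          rw [stepCount, if_pos h3]
          simp only [Pi.sub_apply, Pi.single_eq_same] at h2
          omega
        · exact (hle J _ h2 hJ).trans (stepCount_le_cons _ _ _)
      rcases Nat.even_or_odd (a j) with h | h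
      · rw [dop_even h hj, map_sum]
        exact Submodule.sum_mem _ fun m _ => key m
      · rw [dop_odd h, map_sub]
        refine Submodule.sub_mem _ (key 1) ?_
        have := key 0
        rwa [Pi.single_zero, rho_zero] at this

theorem evalL_block (hψ : ∀ a, ψ a = consL 0 (augFam p _ a + multiD ψ a)) (hL : Antitone L)
    (hχadd : ∀ i g h, χ i (g + h) = χ i g + χ i h)
    (hχ1 : ∀ i m, χ i (Pi.single (L i) m) = m)
    (hχ0 : ∀ i j, L i < j → ∀ m, χ i (Pi.single j m) = 0) (m t u : ℕ)
    (pre : List (Fin α → ZMod p)) (hpre : pre.length + u + 1 = p) (g : Fin α → ZMod p) :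
    evalL (fun l => blockCochain p χ (m + 1) t (pre ++ l))
        (rho g (ψ (blockDeg p L m (t + 1) + Pi.single (L t) u))) =
      vsum p u (blockDeg p L m (t + 1) (L t) + u) (pre.map (χ t)) (χ t g) *
        evalL (blockCochain p χ m (t + 1)) (ψ (blockDeg p L m (t + 1))) := by
  have hp : 2 ≤ p := (Fact.out : p.Prime).two_le
  induction u generalizing pre g with
  | zero =>
    simp only [Pi.single_zero, add_zero, vsum, rho]
    rw [evalL_mapL, mul_comm, ← evalL_mul_right]
    refine evalL_congr ?_ (cone_family_mem hψ _)
    rintro _ ⟨-, l', rfl⟩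
    rw [List.map_cons, blockCochain_append hp _ _ _ _ (by omega), ← List.map_cons,
      blockCochain_map χ χ (g +ᵥ ·) (fun i => χ i g) (fun i v => by simp [hχadd]),
      mul_comm, List.map_append]
    simp
  | succ u ih =>
    set b := blockDeg p L m (t + 1) with hb
    set a := b + Pi.single (L t) (u + 1) with ha
    have haL : a (L t) = b (L t) + u + 1 := by simp [ha, add_assoc]
    have ha0 : a ≠ 0 := fun h => by rw [h] at haL; simp at haL
    have haug : augFam p (Fin α → ZMod p) a = 0 := by simp [augFam, ha0]
    have hcons : ∀ c : List (Fin α → ZMod p) →₀ ZMod p,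
        evalL (fun l => blockCochain p χ (m + 1) t (pre ++ l)) (rho g (consL 0 c)) =
        evalL (fun l => blockCochain p χ (m + 1) t ((pre ++ [g]) ++ l)) (rho g c) := by
      intro c
      rw [rho, mapL_consL, evalL_consL]
      simp
    rw [hψ a, haug, zero_add, hcons, multiD, map_sum, map_sum, Finset.sum_eq_single (L t)]
    · have hsub : a - Pi.single (L t) 1 = b + Pi.single (L t) u := by
        rw [ha, Pi.single_add, ← add_assoc, add_tsub_cancel_right]
      have hk : ksign p a (L t) = 1 := by
        unfold ksign
        rw [Finset.sum_eq_zero, pow_zero]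
        intro j hj
        rw [Finset.mem_Ioi] at hj
        have : b j = 0 := blockDeg_eq_zero fun i hi => (hL (by omega)).trans_lt hj
        simp [ha, this, hj.ne']
      rw [hk, one_smul, hsub, haL, ← add_assoc, vsum]
      have IH := fun h => ih (pre ++ [g]) (by simp; omega) (g + h)
      simp only [List.map_append, List.map_cons, List.map_nil, hχadd] at IH
      have IH1 := fun x => IH (Pi.single (L t) x)
      simp only [hχ1] at IH1
      have IH0 := IH 0
      have hz : χ t 0 = 0 := by simpa using hχadd t 0 0
      rw [hz, add_zero, add_zero] at IH0
      split_ifs with hodd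
      · rw [dop_odd hodd, map_sub, map_sub, rho_rho, IH1, IH0, Nat.add_sub_cancel, sub_mul]
      · rw [dop_even (Nat.not_odd_iff_even.1 hodd) (by omega), map_sum, map_sum, Finset.sum_mul]
        refine Finset.sum_congr rfl fun x _ => ?_
        rw [rho_rho, IH1, Nat.add_sub_cancel]
    · intro j _ hj
      by_cases haj : a j = 0
      · simp [haj]
      have hjL : j < L t := by
        refine lt_of_le_of_ne (not_lt.1 fun hlt => haj ?_) hj
        have : b j = 0 := blockDeg_eq_zero fun i hi => (hL (by omega)).trans_lt hlt
        simp [ha, this, hj]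
      have hmem : rho g (ksign p a j • dop (Fin α → ZMod p) (a j) j (ψ (a - Pi.single j 1))) ∈
          Finsupp.supported (ZMod p) (ZMod p)
            {l : List (Fin α → ZMod p) | a (L t) ≤ stepCount (L t) l} := by
        have hP : ∀ (g : Fin α → ZMod p),
            ∀ l ∈ {l : List (Fin α → ZMod p) | a (L t) ≤ stepCount (L t) l},
            l.map (g +ᵥ ·) ∈ {l : List (Fin α → ZMod p) | a (L t) ≤ stepCount (L t) l} :=
          fun g l hl => by simpa only [Set.mem_ofPred_eq, stepCount_map] using hl
        refine mapL_mem (hP g) (Submodule.smul_mem _ _ (dop_mem hP _ _ ?_))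
        refine Finsupp.supported_mono ?_ (cone_family_mem hψ _)
        rintro l ⟨hl, -⟩
        have := hl (L t)
        simpa [hj.symm] using this
      refine evalL_eq_zero ?_ hmem
      intro l hl
      rw [blockCochain, List.drop_append, List.drop_eq_nil_of_le (by simp; omega), List.nil_append,
        blockCochain_eq_zero_of_stepCount (J := L t), mul_zero]
      · intro i j hij g m
        rw [hχadd, hχ0 i j hij, add_zero]
      · exact fun i hi => hL (by omega)
      · have h1 := stepCount_le_drop (L t) (p - 1 - (pre ++ [g]).length) l
        have h2 : a (L t) ≤ stepCount (L t) l := hl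
        have h3 := congrFun hb (L t)
        simp only [List.length_append, List.length_singleton] at h1 ⊢
        omega
    · simp

/-- The product cochain does not vanish on the cone family. -/
theorem evalL_blockCochain_ne_zero (hψ : ∀ a, ψ a = consL 0 (augFam p _ a + multiD ψ a))
    (hL : Antitone L) (hχadd : ∀ i g h, χ i (g + h) = χ i g + χ i h)
    (hχ1 : ∀ i m, χ i (Pi.single (L i) m) = m)
    (hχ0 : ∀ i j, L i < j → ∀ m, χ i (Pi.single j m) = 0) (m t : ℕ) :
    evalL (blockCochain p χ m t) (ψ (blockDeg p L m t)) ≠ 0 := by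
  have hp : 2 ≤ p := (Fact.out : p.Prime).two_le
  induction m generalizing t with
  | zero =>
    rw [hψ]
    have : multiD ψ (blockDeg p L 0 t) = 0 := Finset.sum_eq_zero fun j _ => by simp [blockDeg]
    rw [this]
    simp [augFam, blockDeg, blockCochain]
  | succ m ih =>
    have h := evalL_block hψ hL hχadd hχ1 hχ0 m t (p - 1) [] (by simp; omega) 0
    have hz : χ t 0 = 0 := by simpa using hχadd t 0 0
    rw [rho_zero, List.map_nil, hz] at h
    simp only [List.nil_append] at h
    rw [blockDeg]
    rw [h]
    exact mul_ne_zero (vsum_ne_zero (dvd_add (dvd_blockDeg _ _ _ _) dvd_rfl) (by omega)) (ih _)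

end Evaluation

section Prism

variable {R : Type*} [CommRing R] {S T : Type*}

/-- The prism over an ordered simplex, interpolating between two vertex maps. -/
noncomputable def prismList (R : Type*) [CommRing R] (f g : S → T) : List S → (List T →₀ R)
  | [] => 0
  | v :: l => Finsupp.single (f v :: g v :: l.map g) 1 - consL (f v) (prismList R f g l)

/-- The prism operator. -/
noncomputable def prism (f g : S → T) : (List S →₀ R) →ₗ[R] (List T →₀ R) :=
  Finsupp.linearCombination R (prismList R f g)

@[simp] theorem prism_single (f g : S → T) (l : List S) :
    prism f g (Finsupp.single l (1 : R)) = prismList R f g l := by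
  simp [prism]

theorem prism_consL (f g : S → T) (v : S) (c : List S →₀ R) :
    prism f g (consL v c) = consL (f v) (consL (g v) (mapL g c)) - consL (f v) (prism f g c) := by
  have : prism f g ∘ₗ consL v = consL (f v) ∘ₗ consL (g v) ∘ₗ mapL g -
      consL (R := R) (f v) ∘ₗ prism f g := lin_ext fun l => by simp [prismList]
  exact LinearMap.congr_fun this c

theorem bdry_prism (f g : S → T) (c : List S →₀ R) :
    bdry (prism f g c) = mapL g c - mapL f c - prism f g (bdry c) := by
  have : bdry ∘ₗ prism f g = mapL g - mapL f - prism (R := R) f g ∘ₗ bdry := by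
    refine lin_ext fun l => ?_
    induction l with
    | nil => simp [prismList, bdryList]
    | cons v l ih =>
      simp only [LinearMap.comp_apply, LinearMap.sub_apply, prism_single, bdry_single,
        mapL_single] at ih ⊢
      have h1 : bdryList R (l.map g) = mapL g (bdryList R l) := by
        rw [← bdry_single, ← mapL_single, bdry_mapL, bdry_single]
      simp only [prismList, map_sub, bdry_single, bdryList, consL_single, bdry_consL, ih, h1,
        prism_consL, prism_single, List.map_cons]
      abel
  exact LinearMap.congr_fun this c

theorem prism_mem {P : Set (List S)} {Q : Set (List T)} {f g : S → T}
    (h : ∀ l ∈ P, ∀ l', (∀ y ∈ l', ∃ x ∈ l, y = f x ∨ y = g x) → l' ∈ Q) {c : List S →₀ R}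
    (hc : c ∈ Finsupp.supported R R P) : prism f g c ∈ Finsupp.supported R R Q := by
  refine lin_mem _ (fun l hl => ?_) hc
  rw [prism_single]
  have key : ∀ l : List S, prismList R f g l ∈
      Finsupp.supported R R {l' | ∀ y ∈ l', ∃ x ∈ l, y = f x ∨ y = g x} := by
    intro l
    induction l with
    | nil => simp [prismList]
    | cons v l ih =>
      refine Submodule.sub_mem _ (single_mem ?_ 1) (consL_mem ?_ ih)
      · intro y hy
        simp only [List.mem_cons, List.mem_map] at hy
        rcases hy with rfl | rfl | ⟨x, hx, rfl⟩
        · exact ⟨v, by simp, Or.inl rfl⟩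
        · exact ⟨v, by simp, Or.inr rfl⟩
        · exact ⟨x, by simp [hx], Or.inr rfl⟩
      · intro l' hl' y hy
        rcases List.mem_cons.1 hy with rfl | hy
        · exact ⟨v, by simp, Or.inl rfl⟩
        · obtain ⟨x, hx, h⟩ := hl' y hy
          exact ⟨x, by simp [hx], h⟩
  exact Finsupp.supported_mono (fun l' hl' => h l hl l' hl') (key l)

/-- If the end of a discrete homotopy starting at the identity is coned off, every cycle bounds. -/
theorem bdry_homotopy_fill (h : ℕ → S → S) (h0 : h 0 = id) (n : ℕ) (v : S) {c : List S →₀ R}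
    (hc : bdry c = 0) :
    bdry (consL v (mapL (h n) c) - ∑ k ∈ Finset.range n, prism (h k) (h (k + 1)) c) = c := by
  have : ∑ k ∈ Finset.range n, bdry (prism (h k) (h (k + 1)) c) = mapL (h n) c - c := by
    simp only [bdry_prism, hc, map_zero, sub_zero]
    rw [Finset.sum_range_sub fun k => mapL (h k) c, h0, mapL_id]
  rw [map_sub, map_sum, this, bdry_consL, bdry_mapL, hc]
  simp

end Prism

section Sorting

variable {R : Type*} [CommRing R] {S T : Type*}

/-- The first element of minimal index in a nonempty list. -/
def minIdx (idx : S → ℕ) : S → List S → S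
  | v, [] => v
  | v, w :: l => minIdx idx (if idx v ≤ idx w then v else w) l

theorem minIdx_mem (idx : S → ℕ) (v : S) (l : List S) : minIdx idx v l ∈ v :: l := by
  induction l generalizing v with
  | nil => simp [minIdx]
  | cons w l ih =>
    have := ih (if idx v ≤ idx w then v else w)
    rw [minIdx]
    split_ifs at * <;> simp only [List.mem_cons] at this ⊢ <;> tauto

theorem minIdx_le (idx : S → ℕ) (v : S) (l : List S) :
    ∀ x ∈ v :: l, idx (minIdx idx v l) ≤ idx x := by
  induction l generalizing v with
  | nil => simp [minIdx]
  | cons w l ih =>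
    have := ih (if idx v ≤ idx w then v else w)
    rw [minIdx]
    simp only [List.mem_cons, forall_eq_or_imp] at this ⊢
    refine ⟨this.1.trans ?_, this.1.trans ?_, this.2⟩ <;> split_ifs <;> omega

theorem minIdx_map {idx : T → ℕ} {idx' : S → ℕ} {f : S → T} (h : ∀ x, idx (f x) = idx' x)
    (v : S) (l : List S) : minIdx idx (f v) (l.map f) = f (minIdx idx' v l) := by
  induction l generalizing v with
  | nil => rfl
  | cons w l ih =>
    rw [List.map_cons, minIdx, minIdx, ← ih, h, h]
    congr 1
    split_ifs <;> rfl

/-- The sorting operator on lists of length `n`. -/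
noncomputable def sortAux (R : Type*) [CommRing R] (idx : S → ℕ) : ℕ → List S → (List S →₀ R)
  | n + 1, v :: l => consL (minIdx idx v l)
      (Finsupp.linearCombination R (sortAux R idx n) (bdryList R (v :: l)))
  | _, _ => Finsupp.single [] 1

/-- The sorting operator: an equivariant chain map to chains on lists sorted by `idx`. -/
noncomputable def sortL (idx : S → ℕ) : (List S →₀ R) →ₗ[R] (List S →₀ R) :=
  Finsupp.linearCombination R fun l => sortAux R idx l.length l

theorem sortL_nil (idx : S → ℕ) :
    sortL idx (Finsupp.single [] (1 : R)) = Finsupp.single [] 1 := by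
  simp [sortL, sortAux]

theorem sortL_cons (idx : S → ℕ) (v : S) (l : List S) :
    sortL idx (Finsupp.single (v :: l) (1 : R)) =
      consL (minIdx idx v l) (sortL idx (bdryList R (v :: l))) := by
  rw [sortL, Finsupp.linearCombination_single, one_smul, List.length_cons, sortAux]
  congr 1
  refine lin_eq_on _ _ ?_ (bdryList_mem (v :: l))
  rintro l' ⟨-, h⟩
  rw [List.length_cons, Nat.add_right_cancel_iff] at h
  simp [h]

theorem bdry_sortL (idx : S → ℕ) (c : List S →₀ R) :
    bdry (sortL idx c) = sortL idx (bdry c) := by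
  have : bdry ∘ₗ sortL idx = sortL (R := R) idx ∘ₗ bdry := by
    refine lin_ext fun l => ?_
    induction hn : l.length using Nat.strong_induction_on generalizing l with
    | _ n ih =>
      rw [LinearMap.comp_apply, LinearMap.comp_apply, bdry_single]
      match l, hn with
      | [], _ => simp [sortL_nil, bdryList]
      | v :: l, hn =>
        rw [sortL_cons, bdry_consL]
        have h : bdry (sortL idx (bdryList R (v :: l))) = sortL idx (bdry (bdryList R (v :: l))) :=
          lin_eq_on (bdry ∘ₗ sortL (R := R) idx) (sortL (R := R) idx ∘ₗ bdry)
            (fun l' hl' => ih l'.length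
              (by have := hl'.2; simp only [List.length_cons] at this hn; omega) l' rfl) (bdryList_mem (v :: l))
        have h2 : bdry (bdryList R (v :: l)) = 0 := by rw [← bdry_single, bdry_bdry]
        rw [h, h2, map_zero, map_zero, sub_zero]
  exact LinearMap.congr_fun this c

theorem sortL_mapL {idx : T → ℕ} {idx' : S → ℕ} {f : S → T} (hf : ∀ x, idx (f x) = idx' x)
    (c : List S →₀ R) : sortL idx (mapL f c) = mapL f (sortL idx' c) := by
  have : sortL idx ∘ₗ mapL f = mapL f ∘ₗ sortL (R := R) idx' := by
    refine lin_ext fun l => ?_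
    induction hn : l.length using Nat.strong_induction_on generalizing l with
    | _ n ih =>
      rw [LinearMap.comp_apply, LinearMap.comp_apply, mapL_single]
      match l, hn with
      | [], _ => simp [sortL_nil]
      | v :: l, hn =>
        have h : sortL idx (mapL f (bdryList R (v :: l))) =
            mapL f (sortL idx' (bdryList R (v :: l))) :=
          lin_eq_on (sortL (R := R) idx ∘ₗ mapL f) (mapL f ∘ₗ sortL (R := R) idx')
            (fun l' hl' => ih l'.length
              (by have := hl'.2; simp only [List.length_cons] at this hn; omega) l' rfl) (bdryList_mem (v :: l))
        rw [sortL_cons, mapL_consL, ← h, List.map_cons, sortL_cons, minIdx_map hf,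
          ← bdry_single, ← List.map_cons, ← mapL_single, bdry_mapL, bdry_single]
  exact LinearMap.congr_fun this c

theorem sortL_mem (idx : S → ℕ) {P : Set (List S)} {c : List S →₀ R}
    (hc : c ∈ Finsupp.supported R R P) :
    sortL idx c ∈ Finsupp.supported R R
      {l' | l'.Pairwise (fun x y => idx x ≤ idx y) ∧ ∃ l ∈ P, l' ⊆ l} := by
  have key : ∀ l : List S, sortL idx (Finsupp.single l (1 : R)) ∈ Finsupp.supported R R
      {l' | l'.Pairwise (fun x y => idx x ≤ idx y) ∧ l' ⊆ l} := by
    intro l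
    induction hn : l.length using Nat.strong_induction_on generalizing l with
    | _ n ih =>
      match l, hn with
      | [], _ => rw [sortL_nil]; exact single_mem (by simp) 1
      | v :: l, hn =>
        rw [sortL_cons]
        have h : sortL idx (bdryList R (v :: l)) ∈ Finsupp.supported R R
            {l' | l'.Pairwise (fun x y => idx x ≤ idx y) ∧ l' ⊆ v :: l} := by
          refine lin_mem _ (fun l' hl' => ?_) (bdryList_mem (v :: l))
          refine Finsupp.supported_mono (s := {q | q.Pairwise (fun x y => idx x ≤ idx y) ∧ q ⊆ l'})
            ?_ (ih l'.length (by have := hl'.2; simp only [List.length_cons] at this hn; omega) l' rfl)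
          exact fun q hq => ⟨hq.1, fun x hx => hl'.1.subset (hq.2 hx)⟩
        refine consL_mem (fun l' hl' => ?_) h
        refine ⟨?_, ?_⟩
        · exact List.pairwise_cons.2 ⟨fun x hx => minIdx_le idx v l x (hl'.2 hx), hl'.1⟩
        · exact List.cons_subset.2 ⟨minIdx_mem idx v l, hl'.2⟩
  refine lin_mem _ (fun l hl => ?_) hc
  refine Finsupp.supported_mono
    (s := {l' | l'.Pairwise (fun x y => idx x ≤ idx y) ∧ l' ⊆ l}) ?_ (key l)
  exact fun l' hl' => ⟨hl'.1, l, hl, hl'.2⟩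

end Sorting

/-- A labelled point of the infinite join of copies of `G`: barycentric coordinates `w` together
with a choice `s` of a vertex in every copy of `G`. -/
@[ext] structure LPt (G : Type*) where
  /-- The barycentric coordinates. -/
  w : ℕ → ℝ
  /-- The vertices. -/
  s : ℕ → G

namespace LPt

variable {G : Type*}

/-- The point `x` lies in the simplex of the `m`-fold join spanned by the vertices `t`. -/
structure Mem (m : ℕ) (t : ℕ → G) (x : LPt G) : Prop where
  nonneg : ∀ j, 0 ≤ x.w j
  eq_zero : ∀ j, m ≤ j → x.w j = 0
  sum_eq : ∑ j ∈ Finset.range m, x.w j = 1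
  eq_s : ∀ j, x.w j ≠ 0 → x.s j = t j

theorem Mem.le_one {m : ℕ} {t : ℕ → G} {x : LPt G} (h : Mem m t x) (j : ℕ) : x.w j ≤ 1 := by
  rcases lt_or_ge j m with hj | hj
  · rw [← h.sum_eq]
    exact Finset.single_le_sum (fun i _ => h.nonneg i) (Finset.mem_range.2 hj)
  · rw [h.eq_zero j hj]; exact zero_le_one

/-- Lists of points of a common simplex of the `m`-fold join, with mesh at most `δ`. -/
def fine (G : Type*) (m : ℕ) (δ : ℝ) : Set (List (LPt G)) :=
  {l | ∃ t, (∀ x ∈ l, Mem m t x) ∧ ∀ x ∈ l, ∀ y ∈ l, ∀ j, |x.w j - y.w j| ≤ δ}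

variable [AddGroup G]

instance : AddAction G (LPt G) where
  vadd g x := ⟨x.w, fun n => g + x.s n⟩
  zero_vadd _ := LPt.ext rfl (funext fun _ => zero_add _)
  add_vadd _ _ _ := LPt.ext rfl (funext fun _ => add_assoc _ _ _)

@[simp] theorem vadd_w (g : G) (x : LPt G) : (g +ᵥ x).w = x.w := rfl

@[simp] theorem vadd_s (g : G) (x : LPt G) (n : ℕ) : (g +ᵥ x).s n = g + x.s n := rfl

theorem fine_vadd {m : ℕ} {δ : ℝ} (g : G) {l : List (LPt G)} (hl : l ∈ fine G m δ) :
    l.map (g +ᵥ ·) ∈ fine G m δ := by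
  obtain ⟨t, ht, hd⟩ := hl
  refine ⟨fun j => g + t j, ?_, ?_⟩
  · intro x hx
    obtain ⟨x, hx', rfl⟩ := List.mem_map.1 hx
    have h := ht x hx'
    exact ⟨h.nonneg, h.eq_zero, h.sum_eq, fun j hj => by rw [vadd_s, h.eq_s j hj]⟩
  · intro x hx y hy
    obtain ⟨x, hx', rfl⟩ := List.mem_map.1 hx
    obtain ⟨y, hy', rfl⟩ := List.mem_map.1 hy
    exact hd x hx' y hy'

/-- `y` is the point of the segment from the new vertex `0` in position `m` to `x` with
parameter `κ`. -/
structure Moved (m : ℕ) (κ : ℝ) (x y : LPt G) : Prop where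
  w_eq : ∀ j, y.w j = κ * x.w j + (1 - κ) * if j = m then 1 else 0
  s_eq : ∀ j, j ≠ m → y.s j = x.s j
  s_zero : κ = 1 ∨ y.s m = 0

theorem Moved.mem {m : ℕ} {κ : ℝ} {x y : LPt G} {t : ℕ → G} (h : Moved m κ x y)
    (h0 : 0 ≤ κ) (h1 : κ ≤ 1) (hx : Mem m t x) : Mem (m + 1) (Function.update t m 0) y where
  nonneg j := by
    have := hx.nonneg j
    have : 0 ≤ 1 - κ := by linarith
    rw [h.w_eq]
    split_ifs <;> positivity
  eq_zero j hj := by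
    rw [h.w_eq, hx.eq_zero j (by omega), if_neg (by omega)]; simp
  sum_eq := by
    rw [Finset.sum_range_succ, h.w_eq, hx.eq_zero m le_rfl, if_pos rfl]
    have : ∑ j ∈ Finset.range m, y.w j = κ * ∑ j ∈ Finset.range m, x.w j := by
      rw [Finset.mul_sum]
      refine Finset.sum_congr rfl fun j hj => ?_
      rw [h.w_eq, if_neg (Finset.mem_range.1 hj).ne]; ring
    rw [this, hx.sum_eq]; ring
  eq_s j hj := by
    rcases eq_or_ne j m with rfl | hjm
    · rw [Function.update_self]
      refine h.s_zero.resolve_left ?_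
      rintro rfl
      exact hj (by rw [h.w_eq, hx.eq_zero j le_rfl]; simp)
    · rw [Function.update_of_ne hjm, h.s_eq j hjm]
      refine hx.eq_s j fun h0 => hj ?_
      rw [h.w_eq, h0, if_neg hjm]; simp

theorem fine_of_moved {m : ℕ} {δ δ' η κ₀ : ℝ} (hδ' : δ + η ≤ δ')
    {l l' : List (LPt G)} (hl : l ∈ fine G m δ)
    (h : ∀ y ∈ l', ∃ x ∈ l, ∃ κ, 0 ≤ κ ∧ κ ≤ 1 ∧ κ ≤ κ₀ ∧ κ₀ ≤ κ + η ∧ Moved m κ x y) :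
    l' ∈ fine G (m + 1) δ' := by
  obtain ⟨t, ht, hd⟩ := hl
  refine ⟨Function.update t m 0, ?_, ?_⟩
  · intro y hy
    obtain ⟨x, hx, κ, h0, h1, -, -, hm⟩ := h y hy
    exact hm.mem h0 h1 (ht x hx)
  · intro y hy y' hy' j
    obtain ⟨x, hx, κ, h0, h1, hk, hk', hm⟩ := h y hy
    obtain ⟨x', hx', κ', h0', h1', hl, hl', hm'⟩ := h y' hy'
    have e1 : |x.w j - x'.w j| ≤ δ := hd x hx x' hx' j
    have e2 : |x'.w j - if j = m then 1 else 0| ≤ 1 := by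
      have := (ht x' hx').nonneg j
      have := (ht x' hx').le_one j
      rw [abs_le]
      split_ifs <;> constructor <;> linarith
    have e3 : |κ - κ'| ≤ η := abs_le.2 ⟨by linarith, by linarith⟩
    have : y.w j - y'.w j = κ * (x.w j - x'.w j) +
        (κ - κ') * (x'.w j - if j = m then 1 else 0) := by
      rw [hm.w_eq, hm'.w_eq]; ring
    rw [this]
    refine (abs_add_le _ _).trans (le_trans ?_ hδ')
    rw [abs_mul, abs_mul, abs_of_nonneg h0]
    refine add_le_add ?_ ?_
    · calc κ * |x.w j - x'.w j| ≤ 1 * δ := mul_le_mul h1 e1 (abs_nonneg _) zero_le_one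
        _ = δ := one_mul _
    · calc |κ - κ'| * |x'.w j - if j = m then 1 else 0| ≤ η * 1 :=
          mul_le_mul e3 e2 (abs_nonneg _) ((abs_nonneg _).trans e3)
        _ = η := mul_one _

/-- The straight-line contraction to the vertex `0` in position `m`. -/
noncomputable def contract (m : ℕ) (K : ℕ) (k : ℕ) (x : LPt G) : LPt G :=
  if k = 0 then x else
    ⟨fun j => (1 - k / K) * x.w j + (1 - (1 - k / K)) * if j = m then 1 else 0,
      Function.update x.s m 0⟩

theorem moved_contract (m K k : ℕ) (x : LPt G) :
    Moved m (1 - k / K) x (contract m K k x) := by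
  unfold contract
  split_ifs with h
  · subst h
    exact ⟨fun j => by simp, fun j _ => rfl, Or.inl (by simp)⟩
  · exact ⟨fun j => rfl, fun j hj => by simp [hj], Or.inr (by simp)⟩

theorem exists_fill (R : Type*) [CommRing R] (m : ℕ) {δ δ' : ℝ} (hδ : 0 ≤ δ) (hδ' : δ < δ') :
    ∃ fill : (List (LPt G) →₀ R) → (List (LPt G) →₀ R),
      ∀ c ∈ Finsupp.supported R R (fine G m δ), bdry c = 0 →
        fill c ∈ Finsupp.supported R R (fine G (m + 1) δ') ∧ bdry (fill c) = c := by
  obtain ⟨n, hn⟩ := exists_nat_one_div_lt (sub_pos.2 hδ')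
  set K := n + 1 with hK
  have hKpos : (0 : ℝ) < K := by rw [hK]; positivity
  have hn' : δ + 1 / K ≤ δ' := by rw [hK]; push_cast; linarith
  let v : LPt G := ⟨fun j => if j = m then 1 else 0, fun _ => 0⟩
  refine ⟨fun c => consL v (mapL (contract m K K) c) -
    ∑ k ∈ Finset.range K, prism (contract m K k) (contract m K (k + 1)) c,
    fun c hc hb => ⟨?_, bdry_homotopy_fill _ (funext fun x => by simp [contract]) K v hb⟩⟩
  refine Submodule.sub_mem _ ?_ (Submodule.sum_mem _ fun k hk => prism_mem ?_ hc)
  · refine consL_mem (P := {l | ∀ x ∈ l, x.w = v.w ∧ x.s m = 0}) (fun l hl => ?_)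
      (mapL_mem (fun l _ => ?_) hc)
    · have key : ∀ x ∈ v :: l, x.w = v.w ∧ x.s m = 0 := by
        intro x hx
        rcases List.mem_cons.1 hx with rfl | hx
        · exact ⟨rfl, rfl⟩
        · exact hl x hx
      refine ⟨fun _ => 0, fun x hx => ?_, fun x hx y hy j => ?_⟩
      · obtain ⟨h1, h2⟩ := key x hx
        refine ⟨fun j => ?_, fun j hj => ?_, ?_, fun j hj => ?_⟩
        · rw [h1]; simp only [v]; split_ifs <;> norm_num
        · rw [h1]; simp only [v]; rw [if_neg (by omega)]
        · rw [h1]; simp [v]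
        · rw [h1] at hj
          simp only [v] at hj
          obtain rfl : j = m := by by_contra h; simp [h] at hj
          exact h2
      · rw [(key x hx).1, (key y hy).1]
        simp; linarith
    · intro y hy
      obtain ⟨x, -, rfl⟩ := List.mem_map.1 hy
      have h := moved_contract m K K x
      rw [div_self hKpos.ne', sub_self] at h
      exact ⟨funext fun j => by rw [h.w_eq]; simp [v], h.s_zero.resolve_left (by norm_num)⟩
  · intro l hl l' hl'
    have hk1 : ((k : ℝ) + 1) / K ≤ 1 := by
      rw [div_le_one hKpos]; exact_mod_cast Finset.mem_range.1 hk
    have hk0 : (0 : ℝ) ≤ k / K := by positivity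
    have hk2 : ((k : ℝ) + 1) / K = k / K + 1 / K := add_div _ _ _
    have hk3 : 0 < 1 / (K : ℝ) := by positivity
    refine fine_of_moved (κ₀ := 1 - k / K) hn' hl fun y hy => ?_
    obtain ⟨x, hx, rfl | rfl⟩ := hl' y hy
    · exact ⟨x, hx, 1 - k / K, by linarith, by linarith, le_rfl, by linarith, moved_contract _ _ _ _⟩
    · refine ⟨x, hx, _, ?_, ?_, ?_, ?_, moved_contract _ _ _ _⟩ <;> push_cast <;> linarith

end LPt

section

variable {p α : ℕ} [Fact p.Prime]

/-- The join carries a resolution family of arbitrarily small mesh. -/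
theorem exists_fine_family {ε : ℝ} (hε : 0 < ε) :
    ∃ φ : (Fin α → ℕ) → (List (LPt (Fin α → ZMod p)) →₀ ZMod p), IsFamily φ ∧
      ∀ a, φ a ∈ Finsupp.supported (ZMod p) (ZMod p)
        (LPt.fine (Fin α → ZMod p) (∑ i, a i + 1) ε) := by
  set δ : ℕ → ℝ := fun m => ε * (1 - 1 / (m + 1)) with hδ
  have hδ0 : ∀ m, 0 ≤ δ m := fun m => by
    refine mul_nonneg hε.le (sub_nonneg.2 ?_)
    rw [div_le_one (by positivity)]; linarith [(m.cast_nonneg : (0 : ℝ) ≤ m)]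
  have hδlt : ∀ m, δ m < δ (m + 1) := fun m => by
    refine mul_lt_mul_of_pos_left (sub_lt_sub_left ?_ 1) hε
    exact one_div_lt_one_div_of_lt (by positivity) (by push_cast; linarith)
  choose fill hfill using fun m => LPt.exists_fill (G := Fin α → ZMod p) (ZMod p) m (hδ0 m) (hδlt m)
  obtain ⟨x, hx⟩ := exists_family (fun m => LPt.fine (Fin α → ZMod p) m (δ m))
    (fun m g l hl => LPt.fine_vadd g hl) fill hfill (augFam p _) 1
    (fun a => by
      unfold augFam
      split_ifs
      · exact single_mem (P := LPt.fine _ _ _) ⟨0, by simp, by simp⟩ 1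
      · exact Submodule.zero_mem _)
    (fun a => by rw [bdry_augFam, multiD_augFam]; simp)
  refine ⟨x, fun a => by rw [(hx a).2.1, one_smul], fun a => ?_⟩
  refine Finsupp.supported_mono ?_ (hx a).1
  rintro l ⟨t, ht, hd⟩
  refine ⟨t, ht, fun x hx y hy j => (hd x hx y hy j).trans ?_⟩
  have : 0 < 1 / ((∑ i, a i + 1 : ℕ) + 1 : ℝ) := by positivity
  simp only [hδ]
  nlinarith

end

section Obstruction

variable {p α : ℕ} [Fact p.Prime] {S : Type*}

theorem blockCochain_eq_zero_of_sorted {lab : ℕ → S → ZMod p} {idx : S → ℕ} {n : ℕ}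
    {l : List S} {m t : ℕ} (hmt : m + t = n)
    (hs : l.Pairwise fun x y => idx x ≤ idx y) (ht : ∀ x ∈ l, t ≤ idx x) (hn : ∀ x ∈ l, idx x < n)
    (hcov : ∀ l' ⊆ l, ∀ i, (∀ x ∈ l', idx x = i) → ¬ ∀ c, ∃ x ∈ l', lab i x = c) :
    blockCochain p lab m t l = 0 := by
  induction m generalizing t l with
  | zero =>
    obtain rfl : l = [] := List.eq_nil_iff_forall_not_mem.2 fun x hx => by
      have := ht x hx; have := hn x hx; omega
    exact blockCochain_nil _ _ _
  | succ m ih =>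
    have hp : 2 ≤ p := (Fact.out : p.Prime).two_le
    rw [blockCochain]
    by_cases hnd : ((l.take p).map (lab t)).Nodup
    swap
    · rw [vdm_eq_zero_of_not_nodup hnd, zero_mul]
    have hsplit : l = l.take (p - 1) ++ l.drop (p - 1) := (List.take_append_drop _ _).symm
    match hd : l.drop (p - 1) with
    | [] => rw [blockCochain_nil, mul_zero]
    | y :: r =>
      have hlen : p ≤ l.length := by
        have := congrArg List.length hd
        simp only [List.length_drop, List.length_cons] at this
        omega
      rw [hd] at hsplit
      have hy : y ∈ l := by rw [hsplit]; simp
      have htake : l.take p = l.take (p - 1) ++ [y] := by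
        have h1 : (l.take (p - 1)).length = p - 1 := by simp; omega
        conv_lhs => rw [hsplit]
        rw [List.take_append, h1, List.take_of_length_le (by omega),
          show p - (p - 1) = 1 by omega]
        rfl
      have hs' := hs
      rw [hsplit, List.pairwise_append] at hs'
      have hyt : idx y ≠ t := by
        intro hyt
        refine hcov (l.take p) (List.take_subset _ _) t (fun x hx => ?_) fun c => ?_
        · refine le_antisymm ?_ (ht x (List.take_subset _ _ hx))
          rw [htake] at hx
          rcases List.mem_append.1 hx with hx | hx
          · exact (hs'.2.2 x hx y (by simp)).trans hyt.le
          · rw [List.mem_singleton.1 hx, hyt]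
        · have hcard : ((l.take p).map (lab t)).toFinset = Finset.univ := by
            refine Finset.eq_univ_of_card _ ?_
            rw [List.toFinset_card_of_nodup hnd, ZMod.card]
            simp [hlen]
          have : c ∈ ((l.take p).map (lab t)).toFinset := by rw [hcard]; simp
          exact List.mem_map.1 (List.mem_toFinset.1 this)
      have hyt' : t + 1 ≤ idx y := by have := ht y hy; omega
      rw [← hd]
      have hsub : l.drop (p - 1) ⊆ l := List.drop_subset _ _
      rw [ih (by omega) (hs.sublist (List.drop_sublist _ _)) ?_ (fun x hx => hn x (hsub hx))
        (fun l' hl' => hcov l' fun x hx => hsub (hl' hx)), mul_zero]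
      intro x hx
      rw [hd] at hx
      rcases List.mem_cons.1 hx with rfl | hx
      · exact hyt'
      · exact hyt'.trans (List.rel_of_pairwise_cons hs'.2.1 hx)

variable [AddAction (Fin α → ZMod p) S]
  {L : ℕ → Fin α} {χ : ℕ → (Fin α → ZMod p) → ZMod p}

/-- Combinatorial form of the Borsuk-Ulam theorem. -/
theorem exists_small_oscillation (n : ℕ) (hL : Antitone L)
    (hχadd : ∀ i g h, χ i (g + h) = χ i g + χ i h)
    (hχ1 : ∀ i m, χ i (Pi.single (L i) m) = m)
    (hχ0 : ∀ i j, L i < j → ∀ m, χ i (Pi.single j m) = 0)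
    (v₀ : S) (β : S → Fin α → ZMod p) (hβ : ∀ (g : Fin α → ZMod p) x, β (g +ᵥ x) = g + β x)
    (f : ℕ → S → ZMod p → ℝ)
    (hf : ∀ i (g : Fin α → ZMod p) x c, f i (g +ᵥ x) (χ i g + c) = f i x c)
    {P : Set (List S)} {η : ℝ} (hP : ∀ l ∈ P, ∀ x ∈ l, ∀ y ∈ l, ∀ i < n, ∀ c,
      |f i x c - f i y c| < η / 2)
    {φ : (Fin α → ℕ) → (List S →₀ ZMod p)} (hφ : IsFamily φ)
    (hφP : φ (blockDeg p L n 0) ∈ Finsupp.supported (ZMod p) (ZMod p) P) :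
    ∃ l ∈ P, ∃ x ∈ l, ∀ i < n, ∀ c c', f i x c - f i x c' < η := by
  by_contra! hcon
  have hp : 2 ≤ p := (Fact.out : p.Prime).two_le
  let Q : S → Set ℕ := fun x => {i | i < n ∧ ∃ c c', η ≤ f i x c - f i x c'}
  have hQ : ∀ (g : Fin α → ZMod p) x, Q (g +ᵥ x) = Q x := by
    intro g x
    have hf' : ∀ i c, f i (g +ᵥ x) c = f i x (c - χ i g) := fun i c => by
      rw [← hf i g x, add_sub_cancel]
    ext i
    refine and_congr_right fun _ => ⟨?_, ?_⟩
    · rintro ⟨c, c', h⟩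
      exact ⟨c - χ i g, c' - χ i g, by rwa [← hf', ← hf']⟩
    · rintro ⟨c, c', h⟩
      exact ⟨χ i g + c, χ i g + c', by rwa [hf, hf]⟩
  let idx : S → ℕ := fun x => sInf (Q x)
  have hidx : ∀ (g : Fin α → ZMod p) x, idx (g +ᵥ x) = idx x := fun g x => by simp only [idx, hQ]
  have hmax : ∀ i x, ∃ c, ∀ c', f i x c' ≤ f i x c := fun i x => Finite.exists_max (f i x)
  choose Λ hΛ using hmax
  let lab : ℕ → S → ZMod p := fun i x => χ i (β x) + Λ i (-β x +ᵥ x)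
  have hlab : ∀ i (g : Fin α → ZMod p) x, lab i (g +ᵥ x) = χ i g + lab i x := by
    intro i g x
    simp only [lab]
    rw [hβ, hχadd, ← add_vadd, neg_add_rev, neg_add_cancel_right, add_assoc]
  have hlabmax : ∀ i x c, f i x c ≤ f i x (lab i x) := by
    intro i x c
    have hx : x = β x +ᵥ (-β x +ᵥ x) := by rw [← add_vadd, add_neg_cancel, zero_vadd]
    have h1 : ∀ c, f i x (χ i (β x) + c) = f i (-β x +ᵥ x) c := fun c => by
      have := hf i (β x) (-β x +ᵥ x) c
      rwa [← hx] at this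
    have h2 := hΛ i (-β x +ᵥ x) (c - χ i (β x))
    rwa [← h1, ← h1, add_sub_cancel] at h2
  have hinv : ∀ (g : Fin α → ZMod p) l,
      blockCochain p lab n 0 (l.map (g +ᵥ ·)) = blockCochain p lab n 0 l := fun g l =>
    blockCochain_map lab lab _ (fun i => χ i g) (fun i x => hlab i g x) n 0 l
  have hcoc := evalL_blockCochain_bdry hp lab n 0
  obtain ⟨ψ, hψ, hψ'⟩ := exists_cone_family p α
  have hfam1 : IsFamily fun a => sortL (R := ZMod p) idx (φ a) :=
    hφ.map _ (bdry_sortL idx) (fun g c => sortL_mapL (hidx g) c) (sortL_nil idx)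
  have hfam2 : IsFamily fun a => mapL (R := ZMod p) (· +ᵥ v₀) (ψ a) := by
    refine hψ.map _ (bdry_mapL _) (fun g c => ?_) (by simp)
    rw [rho, rho, mapL_mapL, mapL_mapL]
    congr 2
    funext h
    exact add_vadd g h v₀
  have heq := evalL_family_eq hinv hcoc v₀ hfam1 hfam2 (blockDeg p L n 0)
  have hzero : evalL (blockCochain p lab n 0) (sortL idx (φ (blockDeg p L n 0))) = 0 := by
    refine evalL_eq_zero (fun l hl => ?_) (sortL_mem idx hφP)
    obtain ⟨hs, l₀, hl₀, hsub⟩ := hl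
    have hmem : ∀ x ∈ l, idx x ∈ Q x := fun x hx => by
      obtain ⟨i, hi, c, c', h⟩ := hcon l₀ hl₀ x (hsub hx)
      exact Nat.sInf_mem ⟨i, hi, c, c', h⟩
    refine blockCochain_eq_zero_of_sorted (add_zero n) hs (fun _ _ => Nat.zero_le _)
      (fun x hx => (hmem x hx).1) fun l' hl' i hi hc => ?_
    obtain ⟨x, hx, -⟩ := hc 0
    have hx' := hmem x (hl' hx)
    rw [hi x hx] at hx'
    obtain ⟨hin, c, c', h⟩ := hx'
    obtain ⟨z, hz, hzc⟩ := hc c'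
    have h1 := hlabmax i z c
    rw [hzc] at h1
    have h2 := hP l₀ hl₀ x (hsub (hl' hx)) z (hsub (hl' hz)) i hin
    have h3 := (abs_lt.1 (h2 c)).2
    have h4 := (abs_lt.1 (h2 c')).1
    linarith
  rw [hzero, evalL_mapL] at heq
  refine evalL_blockCochain_ne_zero hψ' hL hχadd hχ1 hχ0 n 0 ?_
  rw [heq]
  congr 2
  funext l
  exact (blockCochain_map lab χ _ (fun i => lab i v₀)
    (fun i g => by rw [hlab, add_comm]) n 0 l).symm

end Obstruction

section BorsukUlam

variable {p α : ℕ} [Fact p.Prime] {L : ℕ → Fin α} {χ : ℕ → (Fin α → ZMod p) → ZMod p}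

/-- A Borsuk-Ulam theorem for `(ZMod p) ^ α` acting on a join of copies of itself: equivariant
maps to permutation representations indexed by characters have a common constant value. -/
theorem exists_forall_eq {n M : ℕ} (hM : n * (p - 1) + 1 ≤ M) (hL : Antitone L)
    (hχadd : ∀ i g h, χ i (g + h) = χ i g + χ i h)
    (hχ1 : ∀ i m, χ i (Pi.single (L i) m) = m)
    (hχ0 : ∀ i j, L i < j → ∀ m, χ i (Pi.single j m) = 0)
    (f : ℕ → (Fin M → Fin α → ZMod p) → (Fin M → ℝ) → ZMod p → ℝ)
    (hcont : ∀ i s c, Continuous fun w => f i s w c)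
    (hdep : ∀ i s s' w c, (∀ j, w j ≠ 0 → s j = s' j) → f i s w c = f i s' w c)
    (hf : ∀ i g s w c, f i (fun j => g + s j) w (χ i g + c) = f i s w c) :
    ∃ s, ∃ w ∈ stdSimplex ℝ (Fin M), ∀ i < n, ∀ c c', f i s w c = f i s w c' := by
  by_contra! hcon
  set Δ := stdSimplex ℝ (Fin M) with hΔ
  have hΔc : IsCompact Δ := isCompact_stdSimplex ℝ (Fin M)
  have hΔn : Δ.Nonempty := ⟨_, single_mem_stdSimplex ℝ (⟨0, by omega⟩ : Fin M)⟩
  let osc : (Fin M → Fin α → ZMod p) → (Fin M → ℝ) → ℝ := fun s w =>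
    ∑ i ∈ Finset.range n, ∑ c, ∑ c', |f i s w c - f i s w c'|
  have hosc : ∀ s, Continuous (osc s) := fun s =>
    continuous_finsetSum _ fun i _ => continuous_finsetSum _ fun c _ =>
      continuous_finsetSum _ fun c' _ => ((hcont i s c).sub (hcont i s c')).abs
  have hmin := fun s => hΔc.exists_isMinOn hΔn (hosc s).continuousOn
  choose w₀ hw₀ hw₀min using hmin
  obtain ⟨s₀, hs₀⟩ := Finite.exists_min fun s => osc s (w₀ s)
  set η₀ := osc s₀ (w₀ s₀) with hη₀
  have hη₀pos : 0 < η₀ := by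
    obtain ⟨i, hi, c, c', h⟩ := hcon s₀ (w₀ s₀) (hw₀ s₀)
    refine Finset.sum_pos' (fun i _ => Finset.sum_nonneg fun c _ => Finset.sum_nonneg fun c' _ =>
      abs_nonneg _) ⟨i, Finset.mem_range.2 hi, ?_⟩
    refine Finset.sum_pos' (fun c _ => Finset.sum_nonneg fun c' _ => abs_nonneg _)
      ⟨c, Finset.mem_univ c, ?_⟩
    exact Finset.sum_pos' (fun c' _ => abs_nonneg _)
      ⟨c', Finset.mem_univ c', abs_pos.2 (sub_ne_zero.2 h)⟩
  have hη₀le : ∀ s, ∀ w ∈ Δ, η₀ ≤ osc s w := fun s w hw => (hs₀ s).trans (hw₀min s hw)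
  set K : ℝ := n * (p * p) with hK
  have hK0 : 0 ≤ K := by positivity
  set η := η₀ / (K + 1) with hη
  have hηpos : 0 < η := by positivity
  let Φ : (Fin M → ℝ) → ((Fin M → Fin α → ZMod p) × Fin n × ZMod p → ℝ) :=
    fun w q => f q.2.1 q.1 w q.2.2
  have hΦ : Continuous Φ := continuous_pi fun q => hcont _ _ _
  obtain ⟨ε, hε, huc⟩ := Metric.uniformContinuousOn_iff.1
    (hΔc.uniformContinuousOn_of_continuous hΦ.continuousOn) (η / 2) (by positivity)
  obtain ⟨φ, hφ, hφP⟩ := exists_fine_family (p := p) (α := α) (half_pos hε)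
  have hsimplex : ∀ {m : ℕ} {t x}, m ≤ M → LPt.Mem (G := Fin α → ZMod p) m t x →
      (fun j : Fin M => x.w j) ∈ Δ := by
    intro m t x hm hx
    refine ⟨fun j => hx.nonneg j, ?_⟩
    rw [Fin.sum_univ_eq_sum_range (fun j => x.w j) M, ← hx.sum_eq]
    refine (Finset.sum_subset (Finset.range_subset_range.2 hm) fun j _ hj => ?_).symm
    exact hx.eq_zero j (by simpa using hj)
  have hb : ∑ i, blockDeg p L n 0 i + 1 ≤ M := by rwa [sum_blockDeg]
  have hmesh : ∀ l ∈ LPt.fine (Fin α → ZMod p) (∑ i, blockDeg p L n 0 i + 1) (ε / 2),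
      ∀ x ∈ l, ∀ y ∈ l, ∀ i < n, ∀ c, |f i (fun j => x.s j) (fun j => x.w j) c -
        f i (fun j => y.s j) (fun j => y.w j) c| < η / 2 := by
    intro l hl x hx y hy i hi c
    obtain ⟨t, ht, hd⟩ := hl
    have e1 : ∀ z ∈ l, f i (fun j : Fin M => z.s j) (fun j => z.w j) c =
        f i (fun j : Fin M => t j) (fun j => z.w j) c := fun z hz =>
      hdep _ _ _ _ _ fun j hj => (ht z hz).eq_s j hj
    rw [e1 x hx, e1 y hy, ← Real.dist_eq]
    have h1 : dist (fun j : Fin M => x.w j) (fun j : Fin M => y.w j) < ε := by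
      refine lt_of_le_of_lt ((dist_pi_le_iff (half_pos hε).le).2 fun j => ?_) (half_lt_self hε)
      rw [Real.dist_eq]
      exact hd x hx y hy j
    have h2 := huc _ (hsimplex hb (ht x hx)) _ (hsimplex hb (ht y hy)) h1
    exact lt_of_le_of_lt (dist_le_pi_dist (Φ _) (Φ _) (fun j : Fin M => t j, ⟨i, hi⟩, c)) h2
  obtain ⟨l, ⟨t, ht, -⟩, x, hx, hsmall⟩ := exists_small_oscillation (S := LPt (Fin α → ZMod p))
    n hL hχadd hχ1 hχ0 ⟨fun _ => 0, fun _ => 0⟩ (fun x => x.s 0) (fun g x => rfl)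
    (fun i x c => f i (fun j => x.s j) (fun j => x.w j) c)
    (fun i g x c => hf i g (fun j => x.s j) (fun j => x.w j) c) hmesh hφ (hφP _)
  have h1 := hη₀le (fun j => x.s j) (fun j => x.w j) (hsimplex hb (ht x hx))
  have h2 : osc (fun j => x.s j) (fun j => x.w j) ≤ K * η := by
    calc _ ≤ ∑ i ∈ Finset.range n, ∑ c : ZMod p, ∑ c' : ZMod p, η := by
          refine Finset.sum_le_sum fun i hi => Finset.sum_le_sum fun c _ =>
            Finset.sum_le_sum fun c' _ => ?_
          have hi := Finset.mem_range.1 hi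
          have h3 := hsmall i hi c c'
          have h4 := hsmall i hi c' c
          exact abs_le.2 ⟨by linarith, by linarith⟩
      _ = K * η := by simp [ZMod.card, hK]; ring
  have h3 : η₀ = (K + 1) * η := by rw [hη]; field_simp
  linarith

end BorsukUlam

section Radon

variable {p α : ℕ} [Fact p.Prime]

theorem card_dotProduct_eq_zero_mul {d : Fin α → ZMod p} (hd : d ≠ 0) :
    (Finset.univ.filter fun a : Fin α → ZMod p => a ⬝ᵥ d = 0).card * p = p ^ α := by
  obtain ⟨i, hi⟩ := Function.ne_iff.1 hd
  have h : ∀ c : ZMod p, (Finset.univ.filter fun a : Fin α → ZMod p => a ⬝ᵥ d = c).card =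
      (Finset.univ.filter fun a : Fin α → ZMod p => a ⬝ᵥ d = 0).card := by
    intro c
    refine Finset.card_equiv (Equiv.subRight (Pi.single i (c / d i))) fun a => ?_
    have : Pi.single i (c / d i) ⬝ᵥ d = c := by
      rw [single_dotProduct, div_mul_cancel₀ _ hi]
    simp [sub_dotProduct, this, sub_eq_zero]
  have h2 := Finset.card_eq_sum_card_fiberwise (f := fun a : Fin α → ZMod p => a ⬝ᵥ d)
    (s := Finset.univ) (t := Finset.univ) (by simp)
  simp only [h] at h2
  simpa [ZMod.card, mul_comm] using h2.symm

/-- A function on `(ZMod p) ^ α` whose hyperplane sums do not change under translation of the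
hyperplane is constant. -/
theorem eq_of_hyperplane_sums {u : (Fin α → ZMod p) → ℝ}
    (h : ∀ a : Fin α → ZMod p, a ≠ 0 → ∀ c c',
      ∑ g with a ⬝ᵥ g = c, u g = ∑ g with a ⬝ᵥ g = c', u g) (g g' : Fin α → ZMod p) :
    u g = u g' := by
  have hp : 2 ≤ p := (Fact.out : p.Prime).two_le
  set U := ∑ x, u x with hU
  have h1 : ∀ a : Fin α → ZMod p, a ≠ 0 → ∀ c, p * ∑ x with a ⬝ᵥ x = c, u x = U := by
    intro a ha c
    rw [hU, ← Finset.sum_fiberwise Finset.univ (fun x => a ⬝ᵥ x) u,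
      Finset.sum_congr rfl fun c' _ => h a ha c' c]
    simp [ZMod.card]
  have h2 : ∀ g, ∑ a : Fin α → ZMod p, p * ∑ x with a ⬝ᵥ x = a ⬝ᵥ g, u x =
      p * U + ∑ a ∈ Finset.univ.erase (0 : Fin α → ZMod p), U := by
    intro g
    rw [← Finset.add_sum_erase _ _ (Finset.mem_univ 0)]
    congr 1
    · simp [hU]
    · exact Finset.sum_congr rfl fun a ha => h1 a (Finset.ne_of_mem_erase ha) _
  have h3 : ∀ g, ∑ a : Fin α → ZMod p, p * ∑ x with a ⬝ᵥ x = a ⬝ᵥ g, u x =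
      (p : ℝ) ^ α * U + (p - 1) * p ^ α * u g := by
    intro g
    simp only [Finset.sum_filter, Finset.mul_sum]
    rw [Finset.sum_comm, hU, Finset.mul_sum]
    have : (p - 1) * (p : ℝ) ^ α * u g =
        ∑ x, if x = g then (p - 1) * (p : ℝ) ^ α * u x else 0 := by simp
    rw [this, ← Finset.sum_add_distrib]
    refine Finset.sum_congr rfl fun x _ => ?_
    have h4 : ∑ a : Fin α → ZMod p, (p : ℝ) * (if a ⬝ᵥ x = a ⬝ᵥ g then u x else 0) =
        ((Finset.univ.filter fun a : Fin α → ZMod p => a ⬝ᵥ (x - g) = 0).card * p : ℕ) * u x := by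
      simp only [dotProduct_sub, sub_eq_zero]
      rw [← Finset.mul_sum, ← Finset.sum_filter, Finset.sum_const, nsmul_eq_mul]
      push_cast
      ring
    rw [h4]
    split_ifs with hx
    · subst hx
      simp [ZMod.card]
      ring
    · rw [card_dotProduct_eq_zero_mul (sub_ne_zero.2 hx)]
      push_cast
      ring
  have h5 := (h3 g).symm.trans ((h2 g).trans ((h2 g').symm.trans (h3 g')))
  have hp1 : (1 : ℝ) < p := by exact_mod_cast (by omega : 1 < p)
  have hne : ((p : ℝ) - 1) * p ^ α ≠ 0 := mul_ne_zero (by linarith) (by positivity)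
  exact mul_left_cancel₀ hne (add_left_cancel h5)

/-- The vector with leading entry `1` in position `l` and prescribed entries before. -/
def normVec (q : Σ l : Fin α, Fin l → ZMod p) (j : Fin α) : ZMod p :=
  if h : j < q.1 then q.2 ⟨j, h⟩ else if j = q.1 then 1 else 0

theorem exists_smul_normVec {a : Fin α → ZMod p} (ha : a ≠ 0) :
    ∃ q : Σ l : Fin α, Fin l → ZMod p, ∃ c : ZMod p, c ≠ 0 ∧ a = c • normVec q := by
  obtain ⟨i, hi⟩ := Function.ne_iff.1 ha
  obtain ⟨l, hl, hmax⟩ := (Finset.univ.filter fun j => a j ≠ 0).exists_max_image id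
    ⟨i, by simpa using hi⟩
  replace hl : a l ≠ 0 := by simpa using hl
  refine ⟨⟨l, fun j => a ⟨j, by omega⟩ / a l⟩, a l, hl, funext fun j => ?_⟩
  rw [Pi.smul_apply, smul_eq_mul, normVec]
  split_ifs with h1 h2
  · field_simp
  · rw [h2, mul_one]
  · rw [mul_zero]
    by_contra h
    have := hmax j (by simpa using h)
    exact h2 (le_antisymm this (not_lt.1 h1))

theorem card_sigma_mul (hp : p.Prime) :
    Fintype.card (Σ l : Fin α, Fin l → ZMod p) * (p - 1) + 1 = p ^ α := by
  obtain ⟨q, rfl⟩ : ∃ q, p = q + 1 := ⟨p - 1, by have := hp.pos; omega⟩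
  rw [Fintype.card_sigma]
  simp only [Fintype.card_fun, ZMod.card, Fintype.card_fin]
  rw [Fin.sum_univ_eq_sum_range (fun i => (q + 1) ^ i)]
  exact geom_sum_mul_add q α

/-- Equivariant maps from a large join of copies of `(ZMod p) ^ α` to a sum of regular
representations meet the diagonal. -/
theorem exists_forall_const {ι X : Type*} [Fintype ι] [Nonempty ι] [Fintype X] (hα : 1 ≤ α)
    (hX : Fintype.card ι * (p ^ α - 1) + 1 ≤ Fintype.card X)
    (u : ι → (X → Fin α → ZMod p) → (X → ℝ) → (Fin α → ZMod p) → ℝ)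
    (hcont : ∀ j s g, Continuous fun w => u j s w g)
    (hdep : ∀ j s s' w g, (∀ x, w x ≠ 0 → s x = s' x) → u j s w g = u j s' w g)
    (hu : ∀ j g s w h, u j (fun x => g + s x) w (g + h) = u j s w h) :
    ∃ s, ∃ w ∈ stdSimplex ℝ X, ∀ j g g', u j s w g = u j s w g' := by
  classical
  have hp : p.Prime := Fact.out
  let I := ι × Σ l : Fin α, Fin l → ZMod p
  set n := Fintype.card I with hn
  have hn0 : 0 < n := Fintype.card_pos_iff.2
    ⟨(Classical.arbitrary ι, ⟨⟨0, by omega⟩, fun _ => 0⟩)⟩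
  let e₀ : I ≃ Fin n := Fintype.equivFin I
  let σ := Tuple.sort fun i => OrderDual.toDual (e₀.symm i).2.1
  have hσ := Tuple.monotone_sort fun i => OrderDual.toDual (e₀.symm i).2.1
  let E : ℕ → I := fun t => e₀.symm (σ ⟨min t (n - 1), by omega⟩)
  have hE : ∀ q, ∃ t < n, E t = q := fun q => by
    refine ⟨σ.symm (e₀ q), (σ.symm (e₀ q)).2, ?_⟩
    have : (⟨min (σ.symm (e₀ q) : ℕ) (n - 1), by omega⟩ : Fin n) = σ.symm (e₀ q) :=
      Fin.ext (min_eq_left (by have := (σ.symm (e₀ q)).2; omega))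
    simp only [E, this, Equiv.apply_symm_apply, Equiv.symm_apply_apply]
  let L : ℕ → Fin α := fun t => (E t).2.1
  have hL : Antitone L := fun a b hab =>
    hσ (show (⟨min a (n - 1), by omega⟩ : Fin n) ≤ ⟨min b (n - 1), by omega⟩ from
      min_le_min_right _ hab)
  let eX : X ≃ Fin (Fintype.card X) := Fintype.equivFin X
  have hM : n * (p - 1) + 1 ≤ Fintype.card X := by
    have h1 := card_sigma_mul (p := p) (α := α) hp
    have h2 : n * (p - 1) = Fintype.card ι * (p ^ α - 1) := by
      rw [hn, Fintype.card_prod, mul_assoc, ← h1, Nat.add_sub_cancel]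
    rwa [h2]
  obtain ⟨s, w, hw, hsw⟩ := exists_forall_eq (p := p) hM hL
    (χ := fun t g => normVec (E t).2 ⬝ᵥ g) (fun i g h => dotProduct_add _ _ _)
    (fun i m => by simp [normVec, L])
    (fun i j hj m => by
      have h1 : ¬ j < (E i).2.1 := not_lt.2 hj.le
      have h2 : j ≠ (E i).2.1 := hj.ne'
      simp [normVec, h1, h2])
    (fun t s w c => ∑ g with normVec (E t).2 ⬝ᵥ g = c, u (E t).1 (s ∘ eX) (w ∘ eX) g)
    (fun i s c => continuous_finsetSum _ fun g _ =>
      (hcont _ _ g).comp (continuous_pi fun x => continuous_apply _))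
    (fun i s s' w c h => Finset.sum_congr rfl fun g _ => hdep _ _ _ _ _ fun x hx => h _ hx)
    (fun i g s w c => by
      refine (Finset.sum_equiv (Equiv.addLeft g) (fun h => ?_) fun h _ => ?_).symm
      · simp [dotProduct_add]
      · exact (hu _ g (s ∘ eX) _ h).symm)
  refine ⟨s ∘ eX, w ∘ eX, ⟨fun x => hw.1 _, ?_⟩, fun j => eq_of_hyperplane_sums fun a ha c c' => ?_⟩
  · rw [← hw.2]
    exact Equiv.sum_comp eX w
  · obtain ⟨q, b, hb, rfl⟩ := exists_smul_normVec ha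
    obtain ⟨t, ht, hEt⟩ := hE (j, q)
    have h := hsw t ht (b⁻¹ * c) (b⁻¹ * c')
    simp only [hEt] at h
    simp only [smul_dotProduct, smul_eq_mul]
    simp only [eq_inv_mul_iff_mul_eq₀ hb] at h
    exact h

end Radon

section Tverberg

variable {p α : ℕ} [Fact p.Prime]

/-- A colored Tverberg theorem for families of points, with multiplicity `p` in every color. -/
theorem exists_colored_tverberg {X κ : Type*} [Fintype X] [Fintype κ] [DecidableEq κ] {d : ℕ}
    (hα : 1 ≤ α) (pt : X → EuclideanSpace ℝ (Fin d)) (col : X → κ)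
    (hcol : ∀ i, (Finset.univ.filter fun x => col x = i).card < (p + 1) * p ^ α)
    (hX : (d + 1 + Fintype.card κ) * (p ^ α - 1) + 1 ≤ Fintype.card X) :
    ∃ T : (Fin α → ZMod p) → Finset X,
      (∀ g g', g ≠ g' → Disjoint (T g) (T g')) ∧
      (∀ g i, ∀ A ⊆ T g, (∀ x ∈ A, col x = i) → A.card ≤ p) ∧
      (⋂ g, convexHull ℝ (pt '' (T g : Set X))).Nonempty := by
  classical
  let u : Option (Fin d) ⊕ κ → (X → Fin α → ZMod p) → (X → ℝ) → (Fin α → ZMod p) → ℝ :=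
    fun j s w g => match j with
    | .inl none => ∑ x with s x = g, w x
    | .inl (some i) => ∑ x with s x = g, w x * pt x i
    | .inr i => ∑ A ∈ (Finset.univ.filter fun x => col x = i).powersetCard (p + 1),
        if ∀ x ∈ A, s x = g then ∏ x ∈ A, w x else 0
  have hcont : ∀ j s g, Continuous fun w => u j s w g := by
    rintro ((_ | i) | i) s g
    · exact continuous_finsetSum _ fun x _ => continuous_apply x
    · exact continuous_finsetSum _ fun x _ => (continuous_apply x).mul continuous_const
    · refine continuous_finsetSum _ fun A _ => ?_
      split_ifs
      · exact continuous_finsetProd _ fun x _ => continuous_apply x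
      · exact continuous_const
  have hdep : ∀ j s s' w g, (∀ x, w x ≠ 0 → s x = s' x) → u j s w g = u j s' w g := by
    intro j s s' w g h
    have hlin : ∀ φ : X → ℝ, ∑ x with s x = g, w x * φ x = ∑ x with s' x = g, w x * φ x := by
      intro φ
      simp only [Finset.sum_filter]
      refine Finset.sum_congr rfl fun x _ => ?_
      by_cases hx : w x = 0
      · simp [hx]
      · rw [h x hx]
    rcases j with (_ | i) | i
    · simpa using hlin fun _ => 1
    · exact hlin fun x => pt x i
    · refine Finset.sum_congr rfl fun A _ => ?_
      by_cases hA : ∃ x ∈ A, w x = 0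
      · rw [Finset.prod_eq_zero_iff.2 hA]; simp
      · push Not at hA
        have : (∀ x ∈ A, s x = g) ↔ ∀ x ∈ A, s' x = g :=
          forall₂_congr fun x hx => by rw [h x (hA x hx)]
        simp only [this]
  have hu : ∀ j g s w h, u j (fun x => g + s x) w (g + h) = u j s w h := by
    rintro ((_ | i) | i) g s w h <;> simp [u]
  have hcard : Fintype.card (Option (Fin d) ⊕ κ) = d + 1 + Fintype.card κ := by simp
  obtain ⟨s, w, ⟨hw0, hw1⟩, hs⟩ :=
    exists_forall_const (p := p) hα (by rwa [hcard]) u hcont hdep hu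
  have hcolor : ∀ i g, u (.inr i) s w g = 0 := by
    intro i
    obtain ⟨g₀, hg₀⟩ : ∃ g₀, ((Finset.univ.filter fun x => col x = i).filter
        fun x => s x = g₀).card ≤ p := by
      by_contra! hcon
      have h1 := Finset.card_eq_sum_card_fiberwise (f := s)
        (s := Finset.univ.filter fun x => col x = i) (t := Finset.univ) (by simp)
      have h2 : ∑ g : Fin α → ZMod p, (p + 1) ≤ _ := Finset.sum_le_sum fun g _ => hcon g
      rw [← h1] at h2
      have h3 := hcol i
      simp only [Finset.sum_const, Finset.card_univ, Fintype.card_fun, ZMod.card, Fintype.card_fin,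
        smul_eq_mul] at h2
      linarith
    intro g
    refine (hs (.inr i) g g₀).trans ?_
    refine Finset.sum_eq_zero fun A hA => if_neg fun h => ?_
    obtain ⟨hA1, hA2⟩ := Finset.mem_powersetCard.1 hA
    have : A ⊆ (Finset.univ.filter fun x => col x = i).filter fun x => s x = g₀ :=
      fun x hx => Finset.mem_filter.2 ⟨hA1 hx, h x hx⟩
    have := Finset.card_le_card this
    omega
  set W := u (.inl none) s w 0 with hW
  have hWg : ∀ g, ∑ x with s x = g, w x = W := fun g => hs (.inl none) g 0
  have hWpos : 0 < W := by
    refine lt_of_le_of_ne (Finset.sum_nonneg fun x _ => hw0 x) fun h => ?_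
    have h1 := Finset.sum_fiberwise Finset.univ s w
    rw [Finset.sum_congr rfl fun g _ => hWg g, ← h, hw1] at h1
    simp at h1
  let T : (Fin α → ZMod p) → Finset X := fun g => Finset.univ.filter fun x => s x = g ∧ w x ≠ 0
  have hT : ∀ g x, x ∈ T g ↔ s x = g ∧ w x ≠ 0 := fun g x => by simp [T]
  refine ⟨T, fun g g' hg => ?_, fun g i A hA hAc => ?_, ∑ x ∈ T 0, (w x / W) • pt x, ?_⟩
  · exact Finset.disjoint_left.2 fun x hx hx' =>
      hg (((hT g x).1 hx).1.symm.trans ((hT g' x).1 hx').1)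
  · by_contra! hlt
    obtain ⟨B, hBA, hB⟩ := Finset.exists_subset_card_eq hlt
    have h1 := hcolor i g
    have h2 := (Finset.sum_eq_zero_iff_of_nonneg fun A _ => by
      split_ifs
      · exact Finset.prod_nonneg fun x _ => hw0 x
      · exact le_rfl).1 h1 B (Finset.mem_powersetCard.2
        ⟨fun x hx => by simpa using hAc x (hBA hx), hB⟩)
    rw [if_pos fun x hx => ((hT g x).1 (hA (hBA hx))).1, Finset.prod_eq_zero_iff] at h2
    obtain ⟨x, hx, hx0⟩ := h2
    exact ((hT g x).1 (hA (hBA hx))).2 hx0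
  · have hsumT : ∀ (φ : X → ℝ) g, ∑ x ∈ T g, w x * φ x = ∑ x with s x = g, w x * φ x := by
      intro φ g
      refine Finset.sum_subset (fun x hx => by simpa using ((hT g x).1 hx).1) fun x hx hx' => ?_
      have : w x = 0 := by
        by_contra h
        exact hx' ((hT g x).2 ⟨by simpa using hx, h⟩)
      rw [this, zero_mul]
    have heq : ∀ g, ∑ x ∈ T 0, (w x / W) • pt x = ∑ x ∈ T g, (w x / W) • pt x := by
      intro g
      ext i
      have key : ∀ g, (∑ x ∈ T g, (w x / W) • pt x) i = u (.inl (some i)) s w g / W := by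
        intro g
        rw [WithLp.ofLp_sum, Finset.sum_apply]
        simp only [WithLp.ofLp_smul, Pi.smul_apply, smul_eq_mul, div_mul_eq_mul_div]
        rw [← Finset.sum_div, hsumT fun x => pt x i]
      rw [key, key]
      exact congrArg (· / W) (hs (.inl (some i)) 0 g)
    refine Set.mem_iInter.2 fun g => ?_
    rw [heq g]
    refine (convex_convexHull ℝ _).sum_mem (fun x _ => div_nonneg (hw0 x) hWpos.le) ?_
      fun x hx => subset_convexHull ℝ _ ⟨x, hx, rfl⟩
    rw [← Finset.sum_div, div_eq_one_iff_eq hWpos.ne', ← hWg g]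
    simpa using hsumT (fun _ => 1) g

end Tverberg

end ListChain

open scoped Classical

theorem colored_tverberg_with_multiplicities_corollary
    (p α r k : ℕ) (hp : p.Prime) (hα : 1 ≤ α) (hr : r = p ^ α) (hk : 1 ≤ k)
    (C : Fin k → Finset (EuclideanSpace ℝ (Fin (p * k - 1))))
    (hdisj : ∀ i j : Fin k, i ≠ j → Disjoint (C i) (C j))
    (hcard : ∀ i, (C i).card = (p + 1) * r - 1) :
    ∃ F : Fin r → Finset (EuclideanSpace ℝ (Fin (p * k - 1))),
      (∀ s, F s ⊆ Finset.univ.biUnion C) ∧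
      (∀ s t : Fin r, s ≠ t → Disjoint (F s) (F t)) ∧
      (∀ s i, (F s ∩ C i).card ≤ p) ∧
      (⋂ s, convexHull ℝ (↑(F s) : Set (EuclideanSpace ℝ (Fin (p * k - 1))))).Nonempty := by
  have : Fact p.Prime := ⟨hp⟩
  have hr0 : 1 ≤ r := hr ▸ Nat.one_le_pow _ _ hp.pos
  have hpk : 1 ≤ p * k := Nat.mul_pos hp.pos hk
  let pt : (Σ i, C i) → EuclideanSpace ℝ (Fin (p * k - 1)) := fun x => x.2
  have hpt : Function.Injective pt := by
    rintro ⟨i, x, hx⟩ ⟨j, y, hy⟩ (rfl : x = y)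
    obtain rfl : i = j := by
      by_contra h
      exact Finset.disjoint_left.1 (hdisj i j h) hx hy
    rfl
  obtain ⟨T, hTd, hTc, hT⟩ := ListChain.exists_colored_tverberg (p := p) hα pt
    (fun x : Σ i, C i => x.1)
    (fun i => by
      have h1 : (Finset.univ.filter fun x : Σ i, C i => x.1 = i).card ≤ (C i).card := by
        refine Finset.card_le_card_of_injOn pt (fun x hx => ?_) hpt.injOn
        obtain rfl : x.1 = i := by simpa using hx
        exact x.2.2
      rw [hcard, hr] at h1
      have : 0 < (p + 1) * p ^ α := by rw [← hr]; positivity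
      omega)
    (by
      rw [Fintype.card_sigma, Fintype.card_fin, ← hr]
      simp only [Fintype.card_coe, hcard, Finset.sum_const, Finset.card_univ, Fintype.card_fin,
        smul_eq_mul]
      obtain ⟨q, rfl⟩ : ∃ q, r = q + 1 := ⟨r - 1, by omega⟩
      have h1 : p * k - 1 + 1 + k = k * (p + 1) := by
        rw [Nat.sub_add_cancel hpk]; ring
      have h2 : (p + 1) * (q + 1) - 1 = (p + 1) * q + p := by
        rw [mul_add, mul_one]; rfl
      rw [h1, h2, Nat.add_sub_cancel]
      nlinarith)
  have e : Fin r ≃ (Fin α → ZMod p) := Fintype.equivOfCardEq (by simp [hr, ZMod.card])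
  refine ⟨fun s => (T (e s)).image pt, fun s => ?_, fun s t hst => ?_, fun s i => ?_, ?_⟩
  · intro y hy
    obtain ⟨x, -, rfl⟩ := Finset.mem_image.1 hy
    exact Finset.mem_biUnion.2 ⟨x.1, Finset.mem_univ _, x.2.2⟩
  · exact (Finset.disjoint_image hpt).2 (hTd _ _ (e.injective.ne hst))
  · have h1 : (T (e s)).image pt ∩ C i ⊆ ((T (e s)).filter fun x => x.1 = i).image pt := by
      intro y hy
      obtain ⟨hy1, hy2⟩ := Finset.mem_inter.1 hy
      obtain ⟨x, hx, rfl⟩ := Finset.mem_image.1 hy1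
      refine Finset.mem_image_of_mem _ (Finset.mem_filter.2 ⟨hx, ?_⟩)
      by_contra h
      exact Finset.disjoint_left.1 (hdisj _ _ h) x.2.2 hy2
    refine (Finset.card_le_card h1).trans (Finset.card_image_le.trans ?_)
    exact hTc (e s) i _ (Finset.filter_subset _ _) fun x hx => (Finset.mem_filter.1 hx).2
  · obtain ⟨z, hz⟩ := hT
    refine ⟨z, Set.mem_iInter.2 fun s => ?_⟩
    rw [Finset.coe_image]
    exact Set.mem_iInter.1 hz (e s)
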